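/- arXiv:2103.04292 — 3 statements merged into one kernel-verified Lean document; each statement's English description precedes it below -/
import Mathlib

section
/- Let P and Q be two non-negative integrable functions on the real line (with Lebesgue measure). Then there exists a Lebesgue-measurable set A ⊆ ℝ² whose vertical cross section function x ↦ |{y ∈ ℝ : (x,y) ∈ A}| equals P(x) a.e. and whose horizontal cross section function y ↦ |{x ∈ ℝ : (x,y) ∈ A}| equals Q(y) a.e., if and only if the nonincreasing rearrangements p = P* and q = Q* satisfy both ∫₀ˣ p(u) du ≤ ∫₀ˣ λ_Q(u) du for all x > 0 and ∫₀ˣ q(u) du ≤ ∫₀ˣ λ_P(u) du for all x > 0, where λ_f(s) = |{t : |f(t)| > s}| denotes the distribution function. -/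
open MeasureTheory ENNReal

/-- The distribution function `λ_f(s) = μ({x : |f(x)| > s})`. -/
noncomputable def distFn {α : Type*} [MeasurableSpace α] (μ : Measure α) (f : α → ℝ)
    (s : ℝ) : ℝ≥0∞ :=
  μ {x | s < |f x|}

/-- The nonincreasing rearrangement `f*(t) = inf{s > 0 : λ_f(s) ≤ t}` (with value `∞` if no
such `s` exists). -/
noncomputable def rearr {α : Type*} [MeasurableSpace α] (μ : Measure α) (f : α → ℝ)
    (t : ℝ) : ℝ≥0∞ :=
  sInf (ENNReal.ofReal '' {s : ℝ | 0 < s ∧ distFn μ f s ≤ ENNReal.ofReal t})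

/-- Tonelli form of `∫ (α(x) - β(y))₊ = ∫ |{α > t}| |{β ≤ t}| dt`. -/
theorem lintegral_ofReal_sub_eq {α β : ℝ → ℝ} (hα : Measurable α) (hβ : Measurable β)
    (hβ0 : ∀ y, 0 ≤ β y) :
    ∫⁻ z : ℝ × ℝ, ENNReal.ofReal (α z.1 - β z.2) =
      ∫⁻ t in Set.Ioi (0 : ℝ), volume {x | t < α x} * volume {y | t < β y}ᶜ := by
  have hS : MeasurableSet {w : (ℝ × ℝ) × ℝ | β w.1.2 ≤ w.2 ∧ w.2 < α w.1.1} := by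
    refine MeasurableSet.inter (s₁ := {w : (ℝ × ℝ) × ℝ | β w.1.2 ≤ w.2})
      (s₂ := {w : (ℝ × ℝ) × ℝ | w.2 < α w.1.1}) ?_ ?_
    · exact measurableSet_le (by fun_prop) (by fun_prop)
    · exact measurableSet_lt (by fun_prop) (by fun_prop)
  have h1 := Measure.prod_apply (μ := (volume : Measure (ℝ × ℝ)))
    (ν := volume.restrict (Set.Ici (0 : ℝ))) hS
  have h2 := Measure.prod_apply_symm (μ := (volume : Measure (ℝ × ℝ)))
    (ν := volume.restrict (Set.Ici (0 : ℝ))) hS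
  rw [restrict_Ioi_eq_restrict_Ici]
  calc _ = _ := ?_
    _ = _ := h1.symm.trans h2
    _ = _ := ?_
  · refine lintegral_congr fun z ↦ ?_
    have : Prod.mk z ⁻¹' {w : (ℝ × ℝ) × ℝ | β w.1.2 ≤ w.2 ∧ w.2 < α w.1.1} =
        Set.Ico (β z.2) (α z.1) := rfl
    rw [this, Measure.restrict_apply measurableSet_Ico, Set.inter_eq_left.2, Real.volume_Ico]
    exact fun t ht ↦ (hβ0 _).trans ht.1
  · refine lintegral_congr fun t ↦ ?_
    rw [Measure.volume_eq_prod, ← Measure.prod_prod]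
    congr 1
    ext z
    simp [and_comm]

/-- The cut condition implies the dual inequality for nonnegative potentials. -/
theorem lintegral_le_of_cut {ρ σ : Measure ℝ}
    (hcut : ∀ E G : Set ℝ, MeasurableSet E → MeasurableSet G →
      ρ E ≤ σ G + volume E * volume Gᶜ)
    {α β : ℝ → ℝ} (hα : Measurable α) (hβ : Measurable β)
    (hα0 : ∀ x, 0 ≤ α x) (hβ0 : ∀ y, 0 ≤ β y) :
    ∫⁻ x, ENNReal.ofReal (α x) ∂ρ ≤ ∫⁻ y, ENNReal.ofReal (β y) ∂σ +
      ∫⁻ z : ℝ × ℝ, ENNReal.ofReal (α z.1 - β z.2) := by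
  rw [lintegral_eq_lintegral_meas_lt ρ (Filter.Eventually.of_forall hα0) hα.aemeasurable,
    lintegral_eq_lintegral_meas_lt σ (Filter.Eventually.of_forall hβ0) hβ.aemeasurable,
    lintegral_ofReal_sub_eq hα hβ hβ0, ← lintegral_add_left]
  · exact lintegral_mono fun t ↦ hcut _ _ (measurableSet_lt measurable_const hα)
      (measurableSet_lt measurable_const hβ)
  · exact (Antitone.measurable fun s t hst ↦ measure_mono fun y hy ↦ lt_of_le_of_lt hst hy)

theorem distFn_antitone {α : Type*} [MeasurableSpace α] (μ : Measure α) (f : α → ℝ) :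
    Antitone (distFn μ f) :=
  fun _ _ hst ↦ measure_mono fun _ hy ↦ lt_of_le_of_lt hst hy

theorem rearr_eq_volume {α : Type*} [MeasurableSpace α] (μ : Measure α) (f : α → ℝ) (u : ℝ) :
    rearr μ f u = volume.restrict (Set.Ioi 0) {s | ENNReal.ofReal u < distFn μ f s} := by
  have hm : MeasurableSet {s | ENNReal.ofReal u < distFn μ f s} :=
    measurableSet_lt measurable_const (distFn_antitone μ f).measurable
  rw [Measure.restrict_apply hm, rearr]
  apply le_antisymm
  · refine le_of_forall_gt fun c hc ↦ ?_
    by_contra! hcon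
    have key : ∀ s : ℝ, 0 < s → ENNReal.ofReal s < c →
        s ∈ {s | ENNReal.ofReal u < distFn μ f s} := by
      intro s hs hsc
      by_contra hn
      have := sInf_le (Set.mem_image_of_mem ENNReal.ofReal
        (show s ∈ {s : ℝ | 0 < s ∧ distFn μ f s ≤ ENNReal.ofReal u} from ⟨hs, not_lt.1 hn⟩))
      exact absurd (hcon.trans this) (not_le.2 hsc)
    obtain ⟨d, hd1, hd2⟩ := exists_between hc
    have hdt : d ≠ ∞ := hd2.ne_top
    have : d ≤ volume ({s | ENNReal.ofReal u < distFn μ f s} ∩ Set.Ioi 0) := by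
      calc d = volume (Set.Ioo 0 d.toReal) := by simp [ENNReal.ofReal_toReal hdt]
        _ ≤ _ := by
          refine measure_mono fun s hs ↦ ⟨key s hs.1 (lt_trans ?_ hd2), hs.1⟩
          exact (ENNReal.ofReal_lt_iff_lt_toReal hs.1.le hdt).2 hs.2
    exact absurd this (not_le.2 hd1)
  · refine le_sInf ?_
    rintro _ ⟨s, ⟨hs, hsu⟩, rfl⟩
    suffices h : {s | ENNReal.ofReal u < distFn μ f s} ∩ Set.Ioi 0 ⊆ Set.Ioo 0 s by
      simpa using measure_mono (μ := volume) h
    refine fun t ht ↦ ⟨ht.2, ?_⟩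
    by_contra! hst
    exact absurd (ht.1.trans_le (distFn_antitone μ f hst)) (not_lt.2 hsu)

theorem volume_restrict_Ioo_ofReal_lt (x : ℝ) (c : ℝ≥0∞) :
    volume.restrict (Set.Ioo 0 x) {u : ℝ | ENNReal.ofReal u < c} = min (ENNReal.ofReal x) c := by
  have hm : MeasurableSet {u : ℝ | ENNReal.ofReal u < c} :=
    measurableSet_lt ENNReal.measurable_ofReal measurable_const
  rw [Measure.restrict_apply hm]
  rcases eq_or_ne c ∞ with rfl | hc
  · simp
  · have : {u : ℝ | ENNReal.ofReal u < c} ∩ Set.Ioo 0 x = Set.Ioo 0 (min x c.toReal) := by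
      ext u
      simp only [Set.mem_inter_iff, Set.mem_ofPred_eq, Set.mem_Ioo, lt_min_iff]
      constructor
      · rintro ⟨h1, h2, h3⟩
        exact ⟨h2, h3, (ENNReal.ofReal_lt_iff_lt_toReal h2.le hc).1 h1⟩
      · rintro ⟨h2, h3, h1⟩
        exact ⟨(ENNReal.ofReal_lt_iff_lt_toReal h2.le hc).2 h1, h2, h3⟩
    rw [this, Real.volume_Ioo, sub_zero, ENNReal.ofReal_min, ENNReal.ofReal_toReal hc]

theorem setLIntegral_rearr {α : Type*} [MeasurableSpace α] (μ : Measure α) (f : α → ℝ) (x : ℝ) :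
    ∫⁻ u in Set.Ioo 0 x, rearr μ f u =
      ∫⁻ s in Set.Ioi 0, min (ENNReal.ofReal x) (distFn μ f s) := by
  have hS : MeasurableSet {w : ℝ × ℝ | ENNReal.ofReal w.1 < distFn μ f w.2} :=
    measurableSet_lt (by fun_prop) ((distFn_antitone μ f).measurable.comp measurable_snd)
  have h1 := Measure.prod_apply (μ := volume.restrict (Set.Ioo 0 x))
    (ν := volume.restrict (Set.Ioi (0 : ℝ))) hS
  have h2 := Measure.prod_apply_symm (μ := volume.restrict (Set.Ioo 0 x))
    (ν := volume.restrict (Set.Ioi (0 : ℝ))) hS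
  calc _ = _ := lintegral_congr fun u ↦ rearr_eq_volume μ f u
    _ = _ := h1.symm.trans h2
    _ = _ := lintegral_congr fun s ↦ volume_restrict_Ioo_ofReal_lt x (distFn μ f s)

theorem setLIntegral_distFn {α : Type*} [MeasurableSpace α] (μ : Measure α) [SFinite μ]
    {f : α → ℝ} (hf : Measurable f) (hf0 : ∀ a, 0 ≤ f a) (x : ℝ) :
    ∫⁻ u in Set.Ioo 0 x, distFn μ f u =
      ∫⁻ y, min (ENNReal.ofReal x) (ENNReal.ofReal (f y)) ∂μ := by
  have hS : MeasurableSet {w : ℝ × α | w.1 < |f w.2|} :=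
    measurableSet_lt (by fun_prop) (by fun_prop)
  have h1 := Measure.prod_apply (μ := volume.restrict (Set.Ioo 0 x)) (ν := μ) hS
  have h2 := Measure.prod_apply_symm (μ := volume.restrict (Set.Ioo 0 x)) (ν := μ) hS
  calc _ = _ := h1.symm.trans h2
    _ = _ := lintegral_congr fun y ↦ ?_
  rw [← volume_restrict_Ioo_ofReal_lt]
  have hm : MeasurableSet {u : ℝ | ENNReal.ofReal u < ENNReal.ofReal (f y)} :=
    measurableSet_lt ENNReal.measurable_ofReal measurable_const
  have hm' : MeasurableSet ((fun u ↦ (u, y)) ⁻¹' {w : ℝ × α | w.1 < |f w.2|}) :=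
    hS.preimage (by fun_prop)
  rw [Measure.restrict_apply hm, Measure.restrict_apply hm']
  congr 1
  ext u
  simp only [Set.mem_inter_iff, Set.mem_preimage, Set.mem_ofPred_eq, abs_of_nonneg (hf0 y),
    and_congr_left_iff]
  intro hu
  rw [ENNReal.ofReal_lt_ofReal_iff_of_nonneg hu.1.le]

theorem lintegral_distFn {α : Type*} [MeasurableSpace α] (μ : Measure α) {f : α → ℝ}
    (hf : Measurable f) (hf0 : ∀ a, 0 ≤ f a) :
    ∫⁻ s in Set.Ioi 0, distFn μ f s = ∫⁻ a, ENNReal.ofReal (f a) ∂μ := by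
  rw [lintegral_eq_lintegral_meas_lt μ (Filter.Eventually.of_forall hf0) hf.aemeasurable]
  simp [distFn, abs_of_nonneg (hf0 _)]

theorem setLIntegral_ofReal_le {α : Type*} [MeasurableSpace α] (μ : Measure α) {f : α → ℝ}
    (hf : Measurable f) (hf0 : ∀ a, 0 ≤ f a) (E : Set α) :
    ∫⁻ a in E, ENNReal.ofReal (f a) ∂μ ≤ ∫⁻ s in Set.Ioi 0, min (μ E) (distFn μ f s) := by
  rw [← lintegral_distFn _ hf hf0]
  refine lintegral_mono fun s ↦ le_min ?_ ?_
  · exact (measure_mono (Set.subset_univ _)).trans (by simp)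
  · exact Measure.restrict_le_self _

theorem lintegral_le_of_rearr_le {P Q : ℝ → ℝ} (hP : Measurable P) (hQ : Measurable Q)
    (hP0 : ∀ x, 0 ≤ P x) (hQ0 : ∀ y, 0 ≤ Q y)
    (h : ∀ x : ℝ, 0 < x →
      ∫⁻ u in Set.Ioo 0 x, rearr volume P u ≤ ∫⁻ u in Set.Ioo 0 x, distFn volume Q u) :
    ∫⁻ x, ENNReal.ofReal (P x) ≤ ∫⁻ y, ENNReal.ofReal (Q y) := by
  rw [← lintegral_distFn _ hP hP0]
  have key : ∀ s, distFn volume P s =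
      ⨆ n : ℕ, min (ENNReal.ofReal (n + 1 : ℝ)) (distFn volume P s) := by
    intro s
    rw [← iSup_inf_eq]
    have : ⨆ n : ℕ, ENNReal.ofReal (n + 1 : ℝ) = ∞ := by
      refine eq_top_iff.2 ?_
      rw [← ENNReal.iSup_natCast]
      exact iSup_mono fun n ↦ by
        rw [← ENNReal.ofReal_natCast]; exact ENNReal.ofReal_le_ofReal (by linarith)
    simp [this]
  rw [lintegral_congr key]
  rw [lintegral_iSup]
  · refine iSup_le fun n ↦ ?_
    have := h (n + 1) (by positivity)
    rw [setLIntegral_rearr, setLIntegral_distFn _ hQ hQ0] at this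
    exact this.trans (lintegral_mono fun y ↦ min_le_right _ _)
  · exact fun n ↦ measurable_const.min (distFn_antitone _ _).measurable
  · exact fun m n hmn s ↦ min_le_min_right _ (ENNReal.ofReal_le_ofReal (by gcongr))

/-- The inequality between `P*` and `λ_Q`, in the form of a cut condition. -/
theorem cut_of_rearr_le {P Q : ℝ → ℝ} (hP : Measurable P) (hQ : Measurable Q)
    (hP0 : ∀ x, 0 ≤ P x) (hQ0 : ∀ y, 0 ≤ Q y)
    (h : ∀ x : ℝ, 0 < x →
      ∫⁻ u in Set.Ioo 0 x, rearr volume P u ≤ ∫⁻ u in Set.Ioo 0 x, distFn volume Q u)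
    (E G : Set ℝ) (hE : MeasurableSet E) (hG : MeasurableSet G) :
    volume.withDensity (fun x ↦ ENNReal.ofReal (P x)) E ≤
      volume.withDensity (fun y ↦ ENNReal.ofReal (Q y)) G + volume E * volume Gᶜ := by
  have hmass := lintegral_le_of_rearr_le hP hQ hP0 hQ0 h
  rw [withDensity_apply _ hE, withDensity_apply _ hG]
  rcases eq_or_ne (volume E) 0 with h0 | h0
  · rw [setLIntegral_measure_zero _ _ h0]; exact zero_le
  rcases eq_or_ne (volume E) ∞ with htop | htop
  · rcases eq_or_ne (volume Gᶜ) 0 with hG0 | hG0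
    · have : ∫⁻ y in G, ENNReal.ofReal (Q y) = ∫⁻ y, ENNReal.ofReal (Q y) := by
        rw [← lintegral_add_compl (μ := volume) (fun y ↦ ENNReal.ofReal (Q y)) hG,
          setLIntegral_measure_zero _ _ hG0, add_zero]
      rw [this]
      exact (setLIntegral_le_lintegral _ _).trans (hmass.trans le_self_add)
    · rw [htop, ENNReal.top_mul hG0, add_top]; exact le_top
  have hx := h (volume E).toReal (ENNReal.toReal_pos h0 htop)
  rw [setLIntegral_rearr, setLIntegral_distFn _ hQ hQ0, ENNReal.ofReal_toReal htop] at hx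
  refine (setLIntegral_ofReal_le volume hP hP0 E).trans (hx.trans ?_)
  rw [← lintegral_add_compl _ hG]
  refine add_le_add (lintegral_mono fun y ↦ min_le_right _ _) ?_
  calc _ ≤ ∫⁻ _ in Gᶜ, volume E := lintegral_mono fun y ↦ min_le_left _ _
    _ = _ := by simp

/-- A `[0,1]`-valued weight of total mass at most `x` that captures as much as possible of every
superlevel set of `f`. -/
theorem exists_bathtub {f : ℝ → ℝ} (hf : Measurable f)
    (hfi : ∫⁻ a, ENNReal.ofReal (f a) ≠ ∞) {x : ℝ} (hx : 0 < x) :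
    ∃ e : ℝ → ℝ≥0∞, Measurable e ∧ (∀ a, e a ≤ 1) ∧ ∫⁻ a, e a ≤ ENNReal.ofReal x ∧
      ∀ s, 0 < s → min (ENNReal.ofReal x) (volume {a | s < f a}) ≤ ∫⁻ a in {a | s < f a}, e a := by
  have hm : ∀ s, MeasurableSet {a | s < f a} := fun s ↦ measurableSet_lt measurable_const hf
  rcases le_or_gt (volume {a | 0 < f a}) (ENNReal.ofReal x) with h0 | h0
  · refine ⟨Set.indicator {a | 0 < f a} 1, measurable_one.indicator (hm 0), fun a ↦ by
      by_cases ha : 0 < f a <;> simp [Set.indicator, ha], ?_, fun s hs ↦ ?_⟩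
    · simpa [lintegral_indicator (hm 0)] using h0
    · rw [setLIntegral_congr_fun (g := fun _ ↦ 1) (hm s)]
      · simp
      · intro a ha
        simp [Set.indicator, hs.trans (Set.mem_ofPred_eq ▸ ha)]
  have hfin : ∀ s, 0 < s → volume {a | s < f a} ≠ ∞ ∧
      ENNReal.ofReal s * volume {a | s < f a} ≤ ∫⁻ a, ENNReal.ofReal (f a) := by
    intro s hs
    have h1 : ENNReal.ofReal s * volume {a | s < f a} ≤ ∫⁻ a, ENNReal.ofReal (f a) :=
      calc _ ≤ ENNReal.ofReal s * volume {a | ENNReal.ofReal s ≤ ENNReal.ofReal (f a)} := by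
            gcongr with a
            exact fun ha ↦ ENNReal.ofReal_le_ofReal (le_of_lt ha)
        _ ≤ _ := mul_meas_ge_le_lintegral (by fun_prop) _
    refine ⟨fun h ↦ ?_, h1⟩
    rw [h, ENNReal.mul_top (by simpa using hs)] at h1
    exact hfi (top_le_iff.1 h1)
  set T := {s : ℝ | 0 ≤ s ∧ volume {a | s < f a} ≤ ENNReal.ofReal x} with hT
  have hTne : T.Nonempty := by
    set m := (∫⁻ a, ENNReal.ofReal (f a)).toReal
    have hm0 : 0 ≤ m := ENNReal.toReal_nonneg
    have hs : 0 < (m + 1) / x := by positivity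
    refine ⟨(m + 1) / x, hs.le, ?_⟩
    by_contra! hlt
    have h2 := (hfin _ hs).2
    have h3 : ENNReal.ofReal ((m + 1) / x) * ENNReal.ofReal x ≤ ENNReal.ofReal m := by
      rw [ENNReal.ofReal_toReal hfi]
      exact le_trans (by gcongr) h2
    rw [← ENNReal.ofReal_mul hs.le, div_mul_cancel₀ _ hx.ne',
      ENNReal.ofReal_le_ofReal_iff hm0] at h3
    linarith
  have hTb : BddBelow T := ⟨0, fun s hs ↦ hs.1⟩
  set s₀ := sInf T
  have hs₀ : 0 ≤ s₀ := le_csInf hTne fun s hs ↦ hs.1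
  have hle : volume {a | s₀ < f a} ≤ ENNReal.ofReal x := by
    have : {a | s₀ < f a} = ⋃ n : ℕ, {a | s₀ + 1 / (n + 1 : ℝ) < f a} := by
      ext a
      simp only [Set.mem_ofPred_eq, Set.mem_iUnion]
      refine ⟨fun h ↦ ?_, fun ⟨n, hn⟩ ↦ lt_trans (by simp; positivity) hn⟩
      obtain ⟨n, hn⟩ := exists_nat_one_div_lt (sub_pos.2 h)
      exact ⟨n, by linarith⟩
    rw [this, Monotone.measure_iUnion]
    · refine iSup_le fun n ↦ ?_
      obtain ⟨t, ht, hlt⟩ := exists_lt_of_csInf_lt hTne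
        (show sInf T < s₀ + 1 / (n + 1 : ℝ) from lt_add_of_pos_right _ (by positivity))
      exact (measure_mono fun a ha ↦ lt_trans hlt ha).trans ht.2
    · intro m n hmn a ha
      refine lt_of_le_of_lt ?_ (Set.mem_ofPred_eq ▸ ha)
      gcongr
  have hpos : 0 < s₀ := by
    refine lt_of_le_of_ne hs₀ fun h ↦ ?_
    rw [← h] at hle
    exact absurd hle (not_le.2 h0)
  have hlt : ∀ s, 0 < s → s < s₀ → ENNReal.ofReal x ≤ volume {a | s < f a} := by
    intro s hs hss
    by_contra! hcon
    exact absurd (csInf_le hTb (show s ∈ T from ⟨hs.le, hcon.le⟩)) (not_le.2 hss)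
  have hge : ENNReal.ofReal x ≤ volume {a | s₀ ≤ f a} := by
    have : {a | s₀ ≤ f a} = ⋂ n : ℕ, {a | s₀ - s₀ / (n + 2 : ℝ) < f a} := by
      ext a
      simp only [Set.mem_ofPred_eq, Set.mem_iInter]
      refine ⟨fun h n ↦ lt_of_lt_of_le (by simp; positivity) h, fun h ↦ ?_⟩
      by_contra! hcon
      obtain ⟨n, hn⟩ := exists_nat_one_div_lt (div_pos (sub_pos.2 hcon) hpos)
      have h1 := h n
      rw [lt_div_iff₀ hpos] at hn
      have h2 : s₀ / (n + 2 : ℝ) ≤ 1 / (n + 1 : ℝ) * s₀ := by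
        rw [div_mul_eq_mul_div, one_mul]; gcongr; norm_num
      linarith
    rw [this, Antitone.measure_iInter]
    · refine le_iInf fun n ↦ hlt _ (sub_pos.2 (div_lt_self hpos ?_)) (by simp; positivity)
      linarith [n.cast_nonneg (α := ℝ)]
    · intro m n hmn a ha
      refine lt_of_le_of_lt ?_ (Set.mem_ofPred_eq ▸ ha)
      gcongr
    · exact fun n ↦ (hm _).nullMeasurableSet
    · refine ⟨0, (hfin _ ?_).1⟩
      norm_num; linarith
  have hme : MeasurableSet {a | f a = s₀} := measurableSet_eq_fun hf measurable_const
  have hunion : {a | s₀ ≤ f a} = {a | s₀ < f a} ∪ {a | f a = s₀} := by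
    ext a; simp [le_iff_lt_or_eq, eq_comm]
  have hdisj : Disjoint {a | s₀ < f a} {a | f a = s₀} :=
    Set.disjoint_left.2 fun a (ha : s₀ < f a) (hb : f a = s₀) ↦ ha.ne' hb
  rw [hunion, measure_union hdisj hme] at hge
  set b := volume {a | s₀ < f a}
  set d := volume {a | f a = s₀}
  have hd : d ≠ ∞ := by
    refine ne_top_of_le_ne_top (hfin (s₀ / 2) (by positivity)).1 (measure_mono ?_)
    intro a (ha : f a = s₀)
    change s₀ / 2 < f a
    linarith
  set θ := (ENNReal.ofReal x - b) / d
  have hxd : ENNReal.ofReal x - b ≤ d := tsub_le_iff_left.2 hge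
  have hθ1 : θ ≤ 1 := ENNReal.div_le_of_le_mul (by simpa using hxd)
  have hθd : θ * d = ENNReal.ofReal x - b :=
    ENNReal.div_mul_cancel' (fun h ↦ le_zero_iff.1 (h ▸ hxd)) (fun h ↦ absurd h hd)
  have htot : ∀ S, MeasurableSet S → {a | s₀ ≤ f a} ⊆ S →
      ∫⁻ a in S, Set.indicator {a | s₀ < f a} 1 a + Set.indicator {a | f a = s₀} (fun _ ↦ θ) a =
        ENNReal.ofReal x := by
    intro S hS hsub
    rw [hunion, Set.union_subset_iff] at hsub
    rw [lintegral_add_left (measurable_one.indicator (hm s₀)), lintegral_indicator (hm s₀),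
      lintegral_indicator hme, Measure.restrict_restrict (hm s₀), Measure.restrict_restrict hme,
      Set.inter_eq_left.2 hsub.1, Set.inter_eq_left.2 hsub.2]
    simp only [Pi.one_apply, lintegral_const, one_mul, Measure.restrict_apply_univ]
    change b + θ * d = _
    rw [hθd, add_tsub_cancel_of_le hle]
  refine ⟨fun a ↦ Set.indicator {a | s₀ < f a} 1 a + Set.indicator {a | f a = s₀} (fun _ ↦ θ) a,
    (measurable_one.indicator (hm s₀)).add (measurable_const.indicator hme), fun a ↦ ?_, ?_,
    fun s hs ↦ ?_⟩
  · by_cases h1 : s₀ < f a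
    · simp [Set.indicator, h1, h1.ne']
    · by_cases h2 : f a = s₀ <;> simp [Set.indicator, h1, h2, hθ1]
  · rw [← setLIntegral_univ, htot _ MeasurableSet.univ (Set.subset_univ _)]
  · rcases lt_or_ge s s₀ with hss | hss
    · rw [htot _ (hm s) fun a ha ↦ lt_of_lt_of_le hss ha]
      exact min_le_left _ _
    · refine (min_le_right _ _).trans ?_
      calc volume {a | s < f a} = ∫⁻ a in {a | s < f a}, 1 := by simp
        _ ≤ _ := setLIntegral_mono' (hm s) fun a (ha : s < f a) ↦ ?_
      simp [Set.indicator, lt_of_le_of_lt hss ha]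

theorem rearr_le_of_set {P Q : ℝ → ℝ} (hP : Measurable P) (hQ : Measurable Q)
    (hP0 : ∀ x, 0 ≤ P x) (hQ0 : ∀ y, 0 ≤ Q y) (hPi : ∫⁻ a, ENNReal.ofReal (P a) ≠ ∞)
    {A : Set (ℝ × ℝ)} (hA : MeasurableSet A)
    (hAP : ∀ᵐ x : ℝ, volume {y : ℝ | (x, y) ∈ A} = ENNReal.ofReal (P x))
    (hAQ : ∀ᵐ y : ℝ, volume {x : ℝ | (x, y) ∈ A} = ENNReal.ofReal (Q y)) {x : ℝ} (hx : 0 < x) :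
    ∫⁻ u in Set.Ioo 0 x, rearr volume P u ≤ ∫⁻ u in Set.Ioo 0 x, distFn volume Q u := by
  rw [setLIntegral_rearr, setLIntegral_distFn _ hQ hQ0]
  obtain ⟨e, he, he1, hex, hes⟩ := exists_bathtub hP hPi hx
  calc _ ≤ ∫⁻ s in Set.Ioi 0, volume.withDensity e {a | s < P a} := by
        refine setLIntegral_mono' measurableSet_Ioi fun s hs ↦ ?_
        rw [withDensity_apply _ (measurableSet_lt measurable_const hP)]
        simpa [distFn, abs_of_nonneg (hP0 _)] using hes s hs
    _ = ∫⁻ a, e a * ENNReal.ofReal (P a) := by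
        rw [← lintegral_eq_lintegral_meas_lt _ (Filter.Eventually.of_forall hP0) hP.aemeasurable,
          lintegral_withDensity_eq_lintegral_mul _ he (by fun_prop)]
        rfl
    _ = ∫⁻ a, e a * volume {y : ℝ | (a, y) ∈ A} := by
        refine lintegral_congr_ae ?_
        filter_upwards [hAP] with a ha
        rw [ha]
    _ = (volume.withDensity e).prod volume A := by
        rw [Measure.prod_apply hA, lintegral_withDensity_eq_lintegral_mul _ he
          (measurable_measure_prodMk_left hA)]
        rfl
    _ = ∫⁻ y, volume.withDensity e {x | (x, y) ∈ A} := by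
        rw [Measure.prod_apply_symm hA]
        rfl
    _ ≤ _ := by
        refine lintegral_mono_ae ?_
        filter_upwards [hAQ] with y hy
        have hAy : MeasurableSet {x | (x, y) ∈ A} := hA.preimage (by fun_prop)
        rw [← hy, withDensity_apply _ hAy]
        refine le_min ((setLIntegral_le_lintegral _ _).trans hex) ?_
        calc _ ≤ ∫⁻ _ in {x | (x, y) ∈ A}, 1 := lintegral_mono he1
          _ = _ := by simp

theorem exists_smul_translate_inter_pos {T : Set (ℝ × ℝ)} (hT : MeasurableSet T)
    (hTb : Bornology.IsBounded T) (hT0 : volume T ≠ 0) (v : ℝ × ℝ) :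
    ∃ t : ℝ, t ≠ 0 ∧ volume (T ∩ (fun z ↦ z + t • v) ⁻¹' T) ≠ 0 := by
  by_contra! hcon
  obtain ⟨R, hR⟩ := hTb.subset_closedBall 0
  let As : ℕ → Set (ℝ × ℝ) := fun n ↦ (fun z ↦ z + (1 / (n + 1 : ℝ)) • v) ⁻¹' T
  have hAs : ∀ n, volume (As n) = volume T := fun n ↦ measure_preimage_add_right _ _ _
  have hdisj : Pairwise (Function.onFun (AEDisjoint volume) As) := by
    intro m n hmn
    have hne : 1 / (n + 1 : ℝ) - 1 / (m + 1 : ℝ) ≠ 0 := by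
      rw [sub_ne_zero]
      intro h
      rw [div_eq_div_iff (by positivity) (by positivity)] at h
      exact hmn (by exact_mod_cast (by linarith : (m : ℝ) = n))
    have h := hcon _ hne
    rw [← measure_preimage_add_right volume ((1 / (m + 1 : ℝ)) • v)] at h
    refine Eq.trans (congrArg _ ?_) h
    ext z
    simp only [As, Set.mem_inter_iff, Set.mem_preimage, add_assoc, ← add_smul]
    ring_nf
  have hfin := Measure.finite_const_le_meas_of_disjoint_iUnion₀ volume (ε := volume T)
    (pos_iff_ne_zero.2 hT0) (As := As)
    (fun n ↦ (hT.preimage (by fun_prop)).nullMeasurableSet) hdisj ?_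
  · simp only [hAs, le_refl, Set.ofPred_true] at hfin
    exact Set.infinite_univ hfin
  · refine ne_top_of_le_ne_top (b := volume (Metric.closedBall (0 : ℝ × ℝ) (R + ‖v‖)))
      (isCompact_closedBall _ _).measure_ne_top (measure_mono (Set.iUnion_subset fun n z hz ↦ ?_))
    have h1 := hR hz
    rw [mem_closedBall_zero_iff] at h1 ⊢
    have h2 : ‖(1 / (n + 1 : ℝ)) • v‖ ≤ ‖v‖ := by
      rw [norm_smul]
      refine mul_le_of_le_one_left (norm_nonneg _) ?_
      rw [Real.norm_of_nonneg (by positivity), div_le_one (by positivity)]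
      linarith [n.cast_nonneg (α := ℝ)]
    calc ‖z‖ = ‖(z + (1 / (n + 1 : ℝ)) • v) - (1 / (n + 1 : ℝ)) • v‖ := by simp
      _ ≤ _ := (norm_sub_le _ _).trans (add_le_add h1 h2)

theorem abs_alternating_le_one {p q r s : ℝ} (hp : p = 0 ∨ p = 1) (hq : q = 0 ∨ q = 1)
    (hr : r = 0 ∨ r = 1) (hs : s = 0 ∨ s = 1) (hpq : p * q = 0) (hpr : p * r = 0)
    (hps : p * s = 0) (hqr : q * r = 0) (hqs : q * s = 0) (hrs : r * s = 0) :
    |p - q - r + s| ≤ 1 := by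
  rcases hp with rfl | rfl <;> rcases hq with rfl | rfl <;> rcases hr with rfl | rfl <;>
    rcases hs with rfl | rfl <;> norm_num at *

/-- Every bounded plane set of positive measure supports a nonzero function with vanishing
marginals. -/
theorem exists_alternating {T : Set (ℝ × ℝ)} (hT : MeasurableSet T)
    (hTb : Bornology.IsBounded T) (hT0 : volume T ≠ 0) :
    ∃ (S : Set (ℝ × ℝ)) (h : ℝ × ℝ → ℝ), MeasurableSet S ∧ Bornology.IsBounded S ∧
      volume S ≠ 0 ∧ Measurable h ∧ (∀ z, |h z| ≤ T.indicator 1 z) ∧ (∀ z ∈ S, h z = 1) ∧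
      Integrable h ∧
      (∀ α : ℝ → ℝ, Measurable α → (∃ C, ∀ x, |α x| ≤ C) → ∫ z, h z * α z.1 = 0) ∧
      (∀ β : ℝ → ℝ, Measurable β → (∃ C, ∀ y, |β y| ≤ C) → ∫ z, h z * β z.2 = 0) := by
  obtain ⟨a, ha, h1⟩ := exists_smul_translate_inter_pos hT hTb hT0 (1, 0)
  set T₁ := T ∩ (fun z ↦ z + a • ((1 : ℝ), (0 : ℝ))) ⁻¹' T
  have hT₁ : MeasurableSet T₁ := hT.inter (hT.preimage (by fun_prop))
  obtain ⟨b, hb, h2⟩ := exists_smul_translate_inter_pos hT₁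
    (hTb.subset Set.inter_subset_left) h1 (0, 1)
  set T₂ := T₁ ∩ (fun z ↦ z + b • ((0 : ℝ), (1 : ℝ))) ⁻¹' T₁
  have hT₂ : MeasurableSet T₂ := hT₁.inter (hT₁.preimage (by fun_prop))
  set r := min |a| |b| / 2
  have hr : 0 < r := by positivity
  obtain ⟨c, -, hc⟩ := exists_mem_forall_mem_nhdsWithin_pos_measure h2
  set S := T₂ ∩ Metric.ball c r
  have hS : MeasurableSet S := hT₂.inter measurableSet_ball
  have hSpos : 0 < volume S := hc _ (inter_mem_nhdsWithin _ (Metric.ball_mem_nhds c hr))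
  have hSb : Bornology.IsBounded S := hTb.subset fun z hz ↦ hz.1.1.1
  have hdiff : ∀ z w : ℝ × ℝ, z ∈ S → w ∈ S → |z.1 - w.1| < |a| ∧ |z.2 - w.2| < |b| := by
    intro z w hz hw
    have hd : dist z w < 2 * r := by
      have h3 := hz.2
      have h4 := hw.2
      rw [Metric.mem_ball] at h3 h4
      linarith [dist_triangle_right z w c]
    rw [Prod.dist_eq, max_lt_iff, Real.dist_eq, Real.dist_eq] at hd
    have h5 : 2 * r = min |a| |b| := by simp only [r]; ring
    rw [h5] at hd
    exact ⟨hd.1.trans_le (min_le_left _ _), hd.2.trans_le (min_le_right _ _)⟩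
  let k : ℝ × ℝ → ℝ × ℝ → ℝ := fun e z ↦ S.indicator 1 (z - e)
  have hk : ∀ e, Measurable (k e) := fun e ↦
    (measurable_one.indicator hS).comp (measurable_id.sub_const e)
  have hS1 : Integrable (S.indicator (1 : ℝ × ℝ → ℝ)) :=
    (integrable_indicator_iff hS).2 (integrableOn_const hSb.measure_lt_top.ne)
  have hki : ∀ e, Integrable (k e) := fun e ↦ hS1.comp_sub_right e
  have hint : ∀ (e : ℝ × ℝ) (φ : ℝ × ℝ → ℝ),
      ∫ z, k e z * φ z = ∫ z, S.indicator 1 z * φ (z + e) := by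
    intro e φ
    rw [← integral_add_right_eq_self (fun z ↦ k e z * φ z) e]
    simp [k]
  have hkφ : ∀ (e : ℝ × ℝ) (φ : ℝ × ℝ → ℝ), Measurable φ → (∃ C, ∀ z, |φ z| ≤ C) →
      Integrable fun z ↦ k e z * φ z := by
    rintro e φ hφ ⟨C, hC⟩
    exact (hki e).mul_bdd (c := C) hφ.aestronglyMeasurable (Filter.Eventually.of_forall hC)
  have hexp : ∀ φ : ℝ × ℝ → ℝ, Measurable φ → (∃ C, ∀ z, |φ z| ≤ C) →
      ∫ z, (k 0 z - k (a, 0) z - k (0, b) z + k (a, b) z) * φ z =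
        (∫ z, S.indicator 1 z * φ z) - (∫ z, S.indicator 1 z * φ (z + (a, 0))) -
        (∫ z, S.indicator 1 z * φ (z + (0, b))) + ∫ z, S.indicator 1 z * φ (z + (a, b)) := by
    intro φ hφ hC
    simp only [add_mul, sub_mul]
    rw [integral_add, integral_sub, integral_sub, hint, hint, hint, hint]
    · simp
    all_goals first
      | exact hkφ _ φ hφ hC
      | exact (hkφ _ φ hφ hC).sub (hkφ _ φ hφ hC)
      | exact ((hkφ _ φ hφ hC).sub (hkφ _ φ hφ hC)).sub (hkφ _ φ hφ hC)
  have hsep : ∀ z e e' : ℝ × ℝ, |a| ≤ |e'.1 - e.1| ∨ |b| ≤ |e'.2 - e.2| →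
      z - e ∈ S → z - e' ∉ S := by
    intro z e e' h h3 h4
    have h5 := hdiff _ _ h3 h4
    rw [show (z - e).1 - (z - e').1 = e'.1 - e.1 by simp,
      show (z - e).2 - (z - e').2 = e'.2 - e.2 by simp] at h5
    exact h.elim h5.1.not_ge h5.2.not_ge
  have hmem : ∀ e ∈ ({0, (a, 0), (0, b), (a, b)} : Set (ℝ × ℝ)), ∀ z, z - e ∈ S → z ∈ T := by
    intro e he z hz
    have h3 : (z - e ∈ T ∧ z - e + a • ((1 : ℝ), (0 : ℝ)) ∈ T) ∧
        z - e + b • ((0 : ℝ), (1 : ℝ)) ∈ T ∧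
        z - e + b • ((0 : ℝ), (1 : ℝ)) + a • ((1 : ℝ), (0 : ℝ)) ∈ T := hz.1
    have hab : z - (a, b) + ((0, b) : ℝ × ℝ) + (a, 0) = z := by ext <;> simp
    rcases he with rfl | rfl | rfl | rfl
    · simpa using h3.1.1
    · simpa using h3.1.2
    · simpa using h3.2.1
    · simpa [hab] using h3.2.2
  have hk01 : ∀ e z, k e z = 0 ∨ k e z = 1 := fun e z ↦ by
    by_cases he : z - e ∈ S <;> simp [k, he]
  refine ⟨S, fun z ↦ k 0 z - k (a, 0) z - k (0, b) z + k (a, b) z, hS, hSb, hSpos.ne',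
    ((((hk _).sub (hk _)).sub (hk _)).add (hk _)), fun z ↦ ?_, fun z hz ↦ ?_,
    ((((hki _).sub (hki _)).sub (hki _)).add (hki _)), ?_, ?_⟩
  · by_cases hzT : z ∈ T
    · have hmul : ∀ e e' : ℝ × ℝ, |a| ≤ |e'.1 - e.1| ∨ |b| ≤ |e'.2 - e.2| →
          k e z * k e' z = 0 := fun e e' h ↦ by
        by_cases he : z - e ∈ S
        · simp [k, hsep z e e' h he]
        · simp [k, he]
      rw [Set.indicator_of_mem hzT]
      exact abs_alternating_le_one (hk01 _ _) (hk01 _ _) (hk01 _ _) (hk01 _ _)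
        (hmul _ _ (by simp)) (hmul _ _ (by simp)) (hmul _ _ (by simp))
        (hmul _ _ (by simp)) (hmul _ _ (by simp)) (hmul _ _ (by simp))
    · have h4 : ∀ e ∈ ({0, (a, 0), (0, b), (a, b)} : Set (ℝ × ℝ)), k e z = 0 := fun e he ↦
        Set.indicator_of_notMem (fun h ↦ hzT (hmem e he z h)) _
      simp [h4, hzT]
  · rw [← sub_zero z] at hz
    have h1 := hsep z 0 (a, 0) (by simp) hz
    have h2 := hsep z 0 (0, b) (by simp) hz
    have h3 := hsep z 0 (a, b) (by simp) hz
    rw [sub_zero] at hz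
    simp [k, h1, h2, h3, hz]
  · rintro α hα ⟨C, hC⟩
    rw [hexp (fun z ↦ α z.1) (by fun_prop) ⟨C, fun z ↦ hC _⟩]
    simp
  · rintro β hβ ⟨C, hC⟩
    rw [hexp (fun z ↦ β z.2) (by fun_prop) ⟨C, fun z ↦ hC _⟩]
    simp

/-- The Hilbert space `L²(ℝ²)`. -/
abbrev PlaneL2 : Type := Lp ℝ 2 (volume : Measure (ℝ × ℝ))

/-- Upper bounds, by weak duality, for `∫ f g` when `f` takes values in `[0, 1]` and has
marginals `ρ` and `σ`. -/
def dualValues (ρ σ : Measure ℝ) (g : ℝ × ℝ → ℝ) : Set ℝ :=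
  {t | ∃ (α β : ℝ → ℝ) (C c : ℝ), Measurable α ∧ Measurable β ∧ (∀ x, 0 ≤ α x ∧ α x ≤ C) ∧
    (∀ y, 0 ≤ β y ∧ β y ≤ C) ∧ 0 ≤ c ∧
    ∫⁻ z, ENNReal.ofReal (g z + α z.1 - β z.2) ≤ ENNReal.ofReal c ∧
    t = ∫ y, β y ∂σ - ∫ x, α x ∂ρ + c}

theorem integrable_of_mem_Icc {α : Type*} [MeasurableSpace α] {μ : Measure α}
    [IsFiniteMeasure μ] {φ : α → ℝ} (hφ : Measurable φ) {C : ℝ}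
    (hC : ∀ x, 0 ≤ φ x ∧ φ x ≤ C) : Integrable φ μ :=
  Integrable.of_mem_Icc 0 C hφ.aemeasurable (Filter.Eventually.of_forall hC)

section DualValues

variable {ρ σ : Measure ℝ} {g g' : ℝ × ℝ → ℝ} {s t : ℝ}

theorem dualValues_congr (h : g =ᵐ[volume] g') (ht : t ∈ dualValues ρ σ g) :
    t ∈ dualValues ρ σ g' := by
  obtain ⟨α, β, C, c, hα, hβ, hα0, hβ0, hc, hle, rfl⟩ := ht
  refine ⟨α, β, C, c, hα, hβ, hα0, hβ0, hc, ?_, rfl⟩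
  refine le_trans (lintegral_congr_ae ?_).le hle
  filter_upwards [h] with z hz
  rw [hz]

theorem add_mem_dualValues [IsFiniteMeasure ρ] [IsFiniteMeasure σ] (hg : AEMeasurable g)
    (hs : s ∈ dualValues ρ σ g) (ht : t ∈ dualValues ρ σ g') :
    s + t ∈ dualValues ρ σ (g + g') := by
  obtain ⟨α, β, C, c, hα, hβ, hα0, hβ0, hc, hle, rfl⟩ := hs
  obtain ⟨α', β', C', c', hα', hβ', hα0', hβ0', hc', hle', rfl⟩ := ht
  refine ⟨α + α', β + β', C + C', c + c', hα.add hα', hβ.add hβ',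
    fun x ↦ ⟨add_nonneg (hα0 x).1 (hα0' x).1, add_le_add (hα0 x).2 (hα0' x).2⟩,
    fun y ↦ ⟨add_nonneg (hβ0 y).1 (hβ0' y).1, add_le_add (hβ0 y).2 (hβ0' y).2⟩,
    add_nonneg hc hc', ?_, ?_⟩
  · rw [ENNReal.ofReal_add hc hc']
    refine le_trans ?_ (add_le_add hle hle')
    rw [← lintegral_add_left' (by fun_prop)]
    refine lintegral_mono fun z ↦ ?_
    refine le_trans (ENNReal.ofReal_le_ofReal (le_of_eq ?_)) ENNReal.ofReal_add_le
    simp only [Pi.add_apply]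
    ring
  · simp only [Pi.add_apply]
    rw [integral_add (integrable_of_mem_Icc hα hα0) (integrable_of_mem_Icc hα' hα0'),
      integral_add (integrable_of_mem_Icc hβ hβ0) (integrable_of_mem_Icc hβ' hβ0')]
    ring

theorem mul_mem_dualValues {k : ℝ} (hk : 0 < k) (ht : t ∈ dualValues ρ σ g) :
    k * t ∈ dualValues ρ σ (k • g) := by
  obtain ⟨α, β, C, c, hα, hβ, hα0, hβ0, hc, hle, rfl⟩ := ht
  refine ⟨fun x ↦ k * α x, fun y ↦ k * β y, k * C, k * c, by fun_prop, by fun_prop,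
    fun x ↦ ⟨mul_nonneg hk.le (hα0 x).1, mul_le_mul_of_nonneg_left (hα0 x).2 hk.le⟩,
    fun y ↦ ⟨mul_nonneg hk.le (hβ0 y).1, mul_le_mul_of_nonneg_left (hβ0 y).2 hk.le⟩,
    mul_nonneg hk.le hc, ?_, ?_⟩
  · rw [ENNReal.ofReal_mul hk.le]
    refine le_trans (le_of_eq ?_) (mul_le_mul_right hle _)
    rw [← lintegral_const_mul' _ _ ENNReal.ofReal_ne_top]
    refine lintegral_congr fun z ↦ ?_
    rw [← ENNReal.ofReal_mul hk.le]
    congr 1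
    simp only [Pi.smul_apply, smul_eq_mul]
    ring
  · rw [integral_const_mul, integral_const_mul]
    ring

theorem nonneg_of_mem_dualValues_zero [IsFiniteMeasure ρ] [IsFiniteMeasure σ]
    (hcut : ∀ E G : Set ℝ, MeasurableSet E → MeasurableSet G →
      ρ E ≤ σ G + volume E * volume Gᶜ) (ht : t ∈ dualValues ρ σ 0) : 0 ≤ t := by
  obtain ⟨α, β, C, c, hα, hβ, hα0, hβ0, hc, hle, rfl⟩ := ht
  have h := lintegral_le_of_cut hcut hα hβ (fun x ↦ (hα0 x).1) fun y ↦ (hβ0 y).1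
  simp only [Pi.zero_apply, zero_add] at hle
  have hβi : 0 ≤ ∫ y, β y ∂σ := integral_nonneg fun y ↦ (hβ0 y).1
  replace h := h.trans (add_le_add_right hle _)
  rw [← ofReal_integral_eq_lintegral_ofReal (integrable_of_mem_Icc hα hα0)
      (Filter.Eventually.of_forall fun x ↦ (hα0 x).1),
    ← ofReal_integral_eq_lintegral_ofReal (integrable_of_mem_Icc hβ hβ0)
      (Filter.Eventually.of_forall fun y ↦ (hβ0 y).1), ← ENNReal.ofReal_add hβi hc,
    ENNReal.ofReal_le_ofReal_iff (add_nonneg hβi hc)] at h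
  linarith

theorem add_norm_sq_mem_dualValues [IsFiniteMeasure σ]
    (g : PlaneL2) :
    σ.real Set.univ + ‖g‖ ^ 2 ∈ dualValues ρ σ g := by
  refine ⟨0, 1, 1, ‖g‖ ^ 2, measurable_zero, measurable_one, by simp, by simp, by positivity,
    ?_, by simp⟩
  have h : ‖g‖ ^ 2 = ∫ z, g z ^ 2 := by
    rw [← real_inner_self_eq_norm_sq, L2.inner_def]
    simp [sq]
  have hi : Integrable fun z ↦ g z ^ 2 := by
    simpa [sq] using L2.integrable_inner (𝕜 := ℝ) g g
  rw [h, ofReal_integral_eq_lintegral_ofReal hi (Filter.Eventually.of_forall fun z ↦ sq_nonneg _)]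
  refine lintegral_mono fun z ↦ ENNReal.ofReal_le_ofReal ?_
  simp only [Pi.zero_apply, Pi.one_apply]
  nlinarith [sq_nonneg (g z - 1)]

end DualValues

/-- The linear functionals on `L²(ℝ²)` dominated by all the bounds in `dualValues`. -/
def subFunctionals (ρ σ : Measure ℝ) : Set (PlaneL2 → ℝ) :=
  {L : PlaneL2 → ℝ | (∀ f g, L (f + g) = L f + L g) ∧ (∀ (k : ℝ) g, L (k • g) = k * L g) ∧
    ∀ g : PlaneL2, ∀ t ∈ dualValues ρ σ g, L g ≤ t}

section SubFunctionals

variable {ρ σ : Measure ℝ} [IsFiniteMeasure σ]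

open Pointwise in
theorem subFunctionals_nonempty [IsFiniteMeasure ρ]
    (hcut : ∀ E G : Set ℝ, MeasurableSet E → MeasurableSet G →
      ρ E ≤ σ G + volume E * volume Gᶜ) : (subFunctionals ρ σ).Nonempty := by
  set N : PlaneL2 → ℝ := fun g ↦ sInf (dualValues ρ σ g)
  have hne : ∀ g : PlaneL2, (dualValues ρ σ g).Nonempty :=
    fun g ↦ ⟨_, add_norm_sq_mem_dualValues g⟩
  have hadd : ∀ f g : PlaneL2, ∀ s ∈ dualValues ρ σ f,
      ∀ t ∈ dualValues ρ σ g, s + t ∈ dualValues ρ σ (f + g : PlaneL2) := fun f g s hs t ht ↦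
    dualValues_congr (Lp.coeFn_add f g).symm
      (add_mem_dualValues (Lp.aestronglyMeasurable f).aemeasurable hs ht)
  have hsmul : ∀ (g : PlaneL2) (k : ℝ), 0 < k →
      ∀ t ∈ dualValues ρ σ g, k * t ∈ dualValues ρ σ (k • g : PlaneL2) := fun g k hk t ht ↦
    dualValues_congr (Lp.coeFn_smul k g).symm (mul_mem_dualValues hk ht)
  have hbdd : ∀ g : PlaneL2, BddBelow (dualValues ρ σ g) := by
    intro g
    obtain ⟨s, hs⟩ := hne (-g)
    refine ⟨-s, fun t ht ↦ ?_⟩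
    have h := hadd g (-g) t ht s hs
    rw [add_neg_cancel] at h
    linarith [nonneg_of_mem_dualValues_zero hcut (dualValues_congr (Lp.coeFn_zero _ _ _) h)]
  suffices h : ∃ L : PlaneL2 →ₗ[ℝ] ℝ, ∀ g, L g ≤ N g by
    obtain ⟨L, hL⟩ := h
    exact ⟨L, map_add L, fun k g ↦ by simp, fun g t ht ↦ (hL g).trans (csInf_le (hbdd g) ht)⟩
  refine (exists_extension_of_le_sublinear ⟨⊥, 0⟩ N ?_ ?_ ?_).imp fun L hL ↦ hL.2
  · intro k hk g
    have : dualValues ρ σ (k • g : PlaneL2) = k • dualValues ρ σ g := by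
      refine Set.Subset.antisymm (fun t ht ↦ ?_) ?_
      · refine ⟨k⁻¹ * t, ?_, by simp [hk.ne']⟩
        simpa [smul_smul, hk.ne'] using hsmul _ k⁻¹ (inv_pos.2 hk) t ht
      · rintro _ ⟨t, ht, rfl⟩
        exact hsmul g k hk t ht
    simp only [N, this, Real.sInf_smul_of_nonneg hk.le, smul_eq_mul]
  · intro f g
    simp only [N]
    rw [← csInf_add (hne f) (hbdd f) (hne g) (hbdd g)]
    refine csInf_le_csInf (hbdd _) ((hne f).add (hne g)) ?_
    rintro _ ⟨s, hs, t, ht, rfl⟩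
    exact hadd f g s hs t ht
  · rintro ⟨x, hx⟩
    obtain rfl : x = 0 := by simpa using hx
    refine le_csInf (hne _) fun t ht ↦ ?_
    exact nonneg_of_mem_dualValues_zero hcut (dualValues_congr (Lp.coeFn_zero _ _ _) ht)

theorem abs_le_of_mem_subFunctionals {L : PlaneL2 → ℝ}
    (hL : L ∈ subFunctionals ρ σ) (g : PlaneL2) :
    |L g| ≤ σ.real Set.univ + ‖g‖ ^ 2 := by
  refine abs_le'.2 ⟨hL.2.2 g _ (add_norm_sq_mem_dualValues g), ?_⟩
  have h := hL.2.2 (-g) _ (add_norm_sq_mem_dualValues (-g))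
  rw [norm_neg] at h
  rw [← neg_one_smul ℝ g, hL.2.1] at h
  linarith

theorem isCompact_subFunctionals : IsCompact (subFunctionals ρ σ) := by
  refine (isCompact_univ_pi fun g : PlaneL2 ↦
    isCompact_Icc (a := -(σ.real Set.univ + ‖g‖ ^ 2)) (b := σ.real Set.univ + ‖g‖ ^ 2)
    ).of_isClosed_subset ?_ fun L hL g _ ↦ abs_le.1 (abs_le_of_mem_subFunctionals hL g)
  refine IsClosed.inter (s₁ := {L : PlaneL2 → ℝ | ∀ f g, L (f + g) = L f + L g}) ?_
    (IsClosed.inter (s₁ := {L : PlaneL2 → ℝ | ∀ (k : ℝ) g, L (k • g) = k * L g})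
    (s₂ := {L : PlaneL2 → ℝ | ∀ g : PlaneL2, ∀ t ∈ dualValues ρ σ g, L g ≤ t}) ?_ ?_)
  · simp only [Set.ofPred_forall]
    exact isClosed_iInter fun f ↦ isClosed_iInter fun g ↦ isClosed_eq (by fun_prop) (by fun_prop)
  · simp only [Set.ofPred_forall]
    exact isClosed_iInter fun k ↦ isClosed_iInter fun g ↦ isClosed_eq (by fun_prop) (by fun_prop)
  · simp only [Set.ofPred_forall]
    exact isClosed_iInter fun g ↦ isClosed_iInter fun t ↦ isClosed_iInter fun _ ↦
      isClosed_le (by fun_prop) (by fun_prop)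

end SubFunctionals

/-- `f` is the density of a measure on the plane that is dominated by Lebesgue measure and has
marginals `ρ` and `σ`. -/
structure IsPlaneDensity (ρ σ : Measure ℝ) (f : ℝ × ℝ → ℝ) : Prop where
  measurable : Measurable f
  nonneg : ∀ z, 0 ≤ f z
  le_one : ∀ z, f z ≤ 1
  map_fst : (volume.withDensity fun z ↦ ENNReal.ofReal (f z)).map Prod.fst = ρ
  map_snd : (volume.withDensity fun z ↦ ENNReal.ofReal (f z)).map Prod.snd = σ

section Density

variable {ρ σ : Measure ℝ} {f : ℝ × ℝ → ℝ}

theorem IsPlaneDensity.integrable [IsFiniteMeasure ρ] (hf : IsPlaneDensity ρ σ f) :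
    Integrable f := by
  refine ⟨hf.measurable.aestronglyMeasurable, ?_⟩
  rw [hasFiniteIntegral_iff_ofReal (Filter.Eventually.of_forall hf.nonneg),
    ← setLIntegral_univ, ← withDensity_apply _ MeasurableSet.univ,
    ← Set.preimage_univ (f := Prod.fst), ← Measure.map_apply measurable_fst MeasurableSet.univ, hf.map_fst]
  exact measure_lt_top _ _

theorem integral_withDensity_ofReal (hf : Measurable f) (hf0 : ∀ z, 0 ≤ f z)
    (φ : ℝ × ℝ → ℝ) :
    ∫ z, φ z ∂(volume.withDensity fun z ↦ ENNReal.ofReal (f z)) = ∫ z, f z * φ z := by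
  rw [integral_withDensity_eq_integral_toReal_smul (by fun_prop)
    (Filter.Eventually.of_forall fun _ ↦ ENNReal.ofReal_lt_top)]
  simp [ENNReal.toReal_ofReal, hf0]

theorem IsPlaneDensity.integral_fst (hf : IsPlaneDensity ρ σ f) {α : ℝ → ℝ}
    (hα : Measurable α) : ∫ z, f z * α z.1 = ∫ x, α x ∂ρ := by
  rw [← integral_withDensity_ofReal hf.measurable hf.nonneg (fun z ↦ α z.1), ← hf.map_fst,
    integral_map measurable_fst.aemeasurable hα.aestronglyMeasurable]

theorem IsPlaneDensity.integral_snd (hf : IsPlaneDensity ρ σ f) {β : ℝ → ℝ}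
    (hβ : Measurable β) : ∫ z, f z * β z.2 = ∫ y, β y ∂σ := by
  rw [← integral_withDensity_ofReal hf.measurable hf.nonneg (fun z ↦ β z.2), ← hf.map_snd,
    integral_map measurable_snd.aemeasurable hβ.aestronglyMeasurable]

theorem integrable_mul_of_mem_Icc (hf : Measurable f) (hf0 : ∀ z, 0 ≤ f z)
    (hf1 : ∀ z, f z ≤ 1) (hfi : Integrable f) (g : PlaneL2) :
    Integrable fun z ↦ f z * g z := by
  have h2 : MemLp f 2 := by
    rw [memLp_two_iff_integrable_sq hf.aestronglyMeasurable]
    refine hfi.mono (by fun_prop) (Filter.Eventually.of_forall fun z ↦ ?_)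
    rw [Real.norm_of_nonneg (sq_nonneg _), Real.norm_of_nonneg (hf0 z)]
    nlinarith [hf0 z, hf1 z]
  exact h2.integrable_mul (Lp.memLp g)

theorem integral_mem_subFunctionals (hf : Measurable f) (hf0 : ∀ z, 0 ≤ f z)
    (hf1 : ∀ z, f z ≤ 1) (hfi : Integrable f)
    (hfst : ∀ α : ℝ → ℝ, Measurable α → (∃ C, ∀ x, |α x| ≤ C) →
      ∫ z, f z * α z.1 = ∫ x, α x ∂ρ)
    (hsnd : ∀ β : ℝ → ℝ, Measurable β → (∃ C, ∀ y, |β y| ≤ C) →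
      ∫ z, f z * β z.2 = ∫ y, β y ∂σ) :
    (fun g : PlaneL2 ↦ ∫ z, f z * g z) ∈ subFunctionals ρ σ := by
  have hint := integrable_mul_of_mem_Icc hf hf0 hf1 hfi
  refine ⟨fun g g' ↦ ?_, fun k g ↦ ?_, fun g t ht ↦ ?_⟩
  · rw [← integral_add (hint g) (hint g')]
    refine integral_congr_ae ?_
    filter_upwards [Lp.coeFn_add g g'] with z hz
    rw [hz, Pi.add_apply, mul_add]
  · rw [← integral_const_mul]
    refine integral_congr_ae ?_
    filter_upwards [Lp.coeFn_smul k g] with z hz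
    rw [hz, Pi.smul_apply, smul_eq_mul]
    ring
  · obtain ⟨α, β, C, c, hα, hβ, hα0, hβ0, hc, hle, rfl⟩ := ht
    have hαC : ∀ x, |α x| ≤ C := fun x ↦ (abs_of_nonneg (hα0 x).1).trans_le (hα0 x).2
    have hβC : ∀ y, |β y| ≤ C := fun y ↦ (abs_of_nonneg (hβ0 y).1).trans_le (hβ0 y).2
    have hαi : Integrable fun z ↦ f z * α z.1 := hfi.mul_bdd (c := C)
      (hα.comp measurable_fst).aestronglyMeasurable (Filter.Eventually.of_forall fun z ↦ hαC _)
    have hβi : Integrable fun z ↦ f z * β z.2 := hfi.mul_bdd (c := C)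
      (hβ.comp measurable_snd).aestronglyMeasurable (Filter.Eventually.of_forall fun z ↦ hβC _)
    have hgα : Integrable fun z ↦ f z * g z + f z * α z.1 := (hint g).add hαi
    have hi : Integrable fun z ↦ f z * g z + f z * α z.1 - f z * β z.2 := hgα.sub hβi
    have h1 : ∫ z, f z * g z + f z * α z.1 - f z * β z.2 ≤ c := by
      rw [integral_eq_lintegral_pos_part_sub_lintegral_neg_part hi]
      refine (sub_le_self _ ENNReal.toReal_nonneg).trans
        (ENNReal.toReal_le_of_le_ofReal hc (le_trans (lintegral_mono fun z ↦ ?_) hle))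
      rw [show f z * g z + f z * α z.1 - f z * β z.2 = f z * (g z + α z.1 - β z.2) by ring,
        ENNReal.ofReal_mul (hf0 z)]
      exact mul_le_of_le_one_left' (ENNReal.ofReal_le_one.2 (hf1 z))
    rw [integral_sub hgα hβi, integral_add (hint g) hαi,
      hfst α hα ⟨C, hαC⟩, hsnd β hβ ⟨C, hβC⟩] at h1
    linarith


theorem exists_inner_of_mem_subFunctionals [IsFiniteMeasure σ] {L : PlaneL2 → ℝ}
    (hL : L ∈ subFunctionals ρ σ) :
    ∃ F : PlaneL2, ∀ g, L g = inner ℝ F g := by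
  let Llin : PlaneL2 →ₗ[ℝ] ℝ :=
    { toFun := L, map_add' := hL.1, map_smul' := fun k g ↦ by simpa using hL.2.1 k g }
  have hbd : ∀ g, ‖Llin g‖ ≤ (σ.real Set.univ + 1) * ‖g‖ := by
    intro g
    rcases eq_or_ne g 0 with rfl | hg
    · simp
    have hg' : 0 < ‖g‖ := norm_pos_iff.2 hg
    have h := abs_le_of_mem_subFunctionals hL (‖g‖⁻¹ • g)
    rw [hL.2.1, norm_smul, norm_inv, norm_norm, inv_mul_cancel₀ hg'.ne', one_pow, abs_mul,
      abs_of_pos (inv_pos.2 hg'), inv_mul_le_iff₀ hg'] at h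
    rw [mul_comm]
    exact h
  refine ⟨(InnerProductSpace.toDual ℝ PlaneL2).symm (Llin.mkContinuous _ hbd), fun g ↦ ?_⟩
  rw [InnerProductSpace.toDual_symm_apply]
  rfl

theorem measure_le_of_forall_inter_closedBall {E : Type*} [PseudoMetricSpace E]
    [MeasurableSpace E] {μ : Measure E} (x : E) {W : Set E} {b : ℝ≥0∞}
    (h : ∀ n : ℕ, μ (W ∩ Metric.closedBall x n) ≤ b) : μ W ≤ b := by
  have hmono : Monotone fun n : ℕ ↦ W ∩ Metric.closedBall x (n : ℝ) := fun m n hmn ↦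
    Set.inter_subset_inter_right _ (Metric.closedBall_subset_closedBall (by exact_mod_cast hmn))
  rw [← Set.inter_univ W, ← Metric.iUnion_closedBall_nat x, Set.inter_iUnion,
    hmono.measure_iUnion]
  exact iSup_le h

end Density

/-- Every functional in `subFunctionals` is integration against a plane density. -/
theorem exists_isPlaneDensity {ρ σ : Measure ℝ} [IsFiniteMeasure ρ] [IsFiniteMeasure σ]
    (hm : ρ Set.univ = σ Set.univ) {L : PlaneL2 → ℝ} (hL : L ∈ subFunctionals ρ σ) :
    ∃ f, IsPlaneDensity ρ σ f ∧ ∀ g : PlaneL2, L g = ∫ z, f z * g z := by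
  obtain ⟨F, hF⟩ := exists_inner_of_mem_subFunctionals hL
  have hL1 : ∀ {S : Set (ℝ × ℝ)} (hS : MeasurableSet S) (hS' : volume S ≠ ∞),
      L (indicatorConstLp 2 hS hS' 1) = ∫ z in S, F z := fun hS hS' ↦ by
    rw [hF, real_inner_comm, L2.inner_indicatorConstLp_one]
  have hFi : ∀ S, MeasurableSet S → volume S < ∞ → IntegrableOn F S := fun S _ hS' ↦
    integrableOn_Lp_of_measure_ne_top F one_le_two hS'.ne
  have hdual : ∀ {S : Set (ℝ × ℝ)} (hS : MeasurableSet S) (hS' : volume S ≠ ∞) {t : ℝ},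
      t ∈ dualValues ρ σ (S.indicator fun _ ↦ 1) → ∫ z in S, F z ≤ t := fun hS hS' t ht ↦ by
    rw [← hL1 hS hS']
    exact hL.2.2 _ t (dualValues_congr indicatorConstLp_coeFn.symm ht)
  have hdual_neg : ∀ {S : Set (ℝ × ℝ)} (hS : MeasurableSet S) (hS' : volume S ≠ ∞) {t : ℝ},
      t ∈ dualValues ρ σ (S.indicator fun _ ↦ -1) → -t ≤ ∫ z in S, F z := fun {S} hS hS' t ht ↦ by
    have h : -(∫ z in S, F z) ≤ t := by
      rw [← hL1 hS hS', ← neg_one_mul, ← hL.2.1]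
      refine hL.2.2 _ t (dualValues_congr ?_ ht)
      filter_upwards [Lp.coeFn_smul (-1 : ℝ) (indicatorConstLp 2 hS hS' (1 : ℝ)),
        indicatorConstLp_coeFn (p := 2) (hs := hS) (hμs := hS') (c := (1 : ℝ))] with z h1 h2
      rw [h1, Pi.smul_apply, h2]
      by_cases hz : z ∈ S <;> simp [hz]
    linarith
  have hF0 : 0 ≤ᵐ[volume] F := by
    refine ae_nonneg_of_forall_setIntegral_nonneg_of_sigmaFinite hFi fun S hS hS' ↦ ?_
    refine le_trans (by simp) (hdual_neg hS hS'.ne (t := 0)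
      ⟨0, 0, 0, 0, measurable_zero, measurable_zero, by simp, by simp, le_rfl, ?_, by simp⟩)
    refine (lintegral_eq_zero_of_ae_eq_zero (Filter.Eventually.of_forall fun z ↦ ?_)).le.trans
      bot_le
    by_cases hz : z ∈ S <;> simp [hz]
  have hF1 : 0 ≤ᵐ[volume] fun z ↦ 1 - F z := by
    have h1 : ∀ S : Set (ℝ × ℝ), volume S < ∞ → IntegrableOn (fun _ ↦ (1 : ℝ)) S := fun S hS ↦
      integrableOn_const hS.ne
    refine ae_nonneg_of_forall_setIntegral_nonneg_of_sigmaFinite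
      (fun S hS hS' ↦ (h1 S hS').sub (hFi S hS hS')) fun S hS hS' ↦ ?_
    rw [integral_sub (h1 S hS') (hFi S hS hS'), sub_nonneg]
    refine (hdual hS hS'.ne (t := volume.real S) ⟨0, 0, 0, volume.real S, measurable_zero,
      measurable_zero, by simp, by simp, by positivity, ?_, by simp⟩).trans (by simp)
    rw [measureReal_def, ENNReal.ofReal_toReal hS'.ne, ← lintegral_indicator_one hS]
    refine lintegral_mono fun z ↦ ?_
    by_cases hz : z ∈ S <;> simp [hz]
  have hFm := Lp.aestronglyMeasurable F
  set f : ℝ × ℝ → ℝ := fun z ↦ max 0 (min 1 (hFm.mk F z))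
  have hfm : Measurable f := measurable_const.max
    (measurable_const.min hFm.stronglyMeasurable_mk.measurable)
  have hfF : f =ᵐ[volume] F := by
    filter_upwards [hF0, hF1, hFm.ae_eq_mk] with z h0 h1 h2
    simp only [f, ← h2]
    rw [min_eq_right (by simpa using h1), max_eq_right (by simpa using h0)]
  have hf0 : ∀ z, 0 ≤ f z := fun z ↦ le_max_left _ _
  have hf1 : ∀ z, f z ≤ 1 := fun z ↦ max_le zero_le_one (min_le_left _ _)
  set γ : Measure (ℝ × ℝ) := volume.withDensity fun z ↦ ENNReal.ofReal (f z)
  have hγ : ∀ S, MeasurableSet S → volume S < ∞ → γ S = ENNReal.ofReal (∫ z in S, F z) := by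
    intro S hS hS'
    rw [withDensity_apply _ hS, ← integral_congr_ae (ae_restrict_of_ae hfF),
      ofReal_integral_eq_lintegral_ofReal ((hFi S hS hS').congr (ae_restrict_of_ae hfF.symm))
        (Filter.Eventually.of_forall hf0)]
  have hball : ∀ n : ℕ, volume (Metric.closedBall (0 : ℝ × ℝ) n) < ∞ := fun n ↦
    measure_closedBall_lt_top
  have hle : ∀ W : Set (ℝ × ℝ), MeasurableSet W → ∀ b : ℝ≥0∞, b ≠ ∞ →
      (∀ S ⊆ W, b.toReal ∈ dualValues ρ σ (S.indicator fun _ ↦ 1)) → γ W ≤ b := by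
    intro W hW b hb h
    refine measure_le_of_forall_inter_closedBall 0 fun n ↦ ?_
    have hS := hW.inter (measurableSet_closedBall (x := (0 : ℝ × ℝ)) (ε := n))
    have hS' : volume (W ∩ Metric.closedBall 0 (n : ℝ)) < ∞ :=
      (measure_mono Set.inter_subset_right).trans_lt (hball n)
    rw [hγ _ hS hS']
    exact ENNReal.ofReal_le_of_le_toReal (hdual hS hS'.ne (h _ Set.inter_subset_left))
  have h01 : ∀ (E : Set ℝ) (x : ℝ),
      0 ≤ E.indicator (1 : ℝ → ℝ) x ∧ E.indicator (1 : ℝ → ℝ) x ≤ 1 :=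
    fun E x ↦ by by_cases hx : x ∈ E <;> simp [hx]
  have hfst : ∀ E, MeasurableSet E → γ (Prod.fst ⁻¹' E) ≤ ρ E := by
    intro E hE
    refine hle _ (measurable_fst hE) _ (measure_ne_top _ _) fun S hS ↦ ?_
    refine ⟨Eᶜ.indicator 1, 1, 1, 0, measurable_one.indicator hE.compl, measurable_one,
      h01 _, by simp, le_rfl, ?_, ?_⟩
    · refine (lintegral_eq_zero_of_ae_eq_zero (Filter.Eventually.of_forall fun z ↦ ?_)).le.trans
        bot_le
      by_cases hz : z ∈ S
      · have : z.1 ∈ E := hS hz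
        simp [hz, this]
      · simpa [hz] using (h01 Eᶜ z.1).2
    · rw [integral_indicator_one hE.compl, measureReal_compl hE]
      simp [measureReal_def, hm]
  have hsnd : ∀ E, MeasurableSet E → γ (Prod.snd ⁻¹' E) ≤ σ E := by
    intro E hE
    refine hle _ (measurable_snd hE) _ (measure_ne_top _ _) fun S hS ↦ ?_
    refine ⟨0, E.indicator 1, 1, 0, measurable_zero, measurable_one.indicator hE, by simp,
      h01 _, le_rfl, ?_, ?_⟩
    · refine (lintegral_eq_zero_of_ae_eq_zero (Filter.Eventually.of_forall fun z ↦ ?_)).le.trans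
        bot_le
      by_cases hz : z ∈ S
      · have : z.2 ∈ E := hS hz
        simp [hz, this]
      · simpa [hz] using (h01 E z.2).1
    · rw [integral_indicator_one hE]
      simp [measureReal_def]
  have huniv : ρ Set.univ ≤ γ Set.univ := by
    set I : ℕ → Set ℝ := fun n ↦ Metric.closedBall 0 n
    have hI : ∀ n, MeasurableSet (I n) := fun n ↦ measurableSet_closedBall
    have hII : ∀ n, volume (I n ×ˢ I n) < ∞ := fun n ↦ by
      simp only [I, closedBall_prod_same]
      exact hball n
    have hn : ∀ n, ρ (I n) + σ (I n) ≤ γ Set.univ + σ Set.univ := by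
      intro n
      have h1 := hdual_neg (S := I n ×ˢ I n) ((hI n).prod (hI n)) (hII n).ne
        ⟨(I n).indicator 1, (I n)ᶜ.indicator 1, 1, 0, measurable_one.indicator (hI n),
          measurable_one.indicator (hI n).compl, h01 _, h01 _, le_rfl, ?_, rfl⟩
      · rw [integral_indicator_one (hI n), integral_indicator_one (hI n).compl,
          measureReal_compl (hI n)] at h1
        have h2 : γ (I n ×ˢ I n) = _ := hγ _ ((hI n).prod (hI n)) (hII n)
        refine le_trans ?_ (add_le_add_left (measure_mono (Set.subset_univ (I n ×ˢ I n))) _)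
        rw [h2, ← ofReal_measureReal (μ := ρ) (s := I n), ← ofReal_measureReal (μ := σ) (s := I n),
          ← ofReal_measureReal (μ := σ) (s := Set.univ), ← ENNReal.ofReal_add (by positivity)
          (by positivity)]
        refine le_trans (ENNReal.ofReal_le_ofReal ?_) ENNReal.ofReal_add_le
        linarith
      · refine (lintegral_eq_zero_of_ae_eq_zero
          (Filter.Eventually.of_forall fun z ↦ ?_)).le.trans bot_le
        by_cases hz1 : z.1 ∈ I n <;> by_cases hz2 : z.2 ∈ I n <;>
          simp [Set.mem_prod, hz1, hz2]
    have hImono : Monotone I := fun m n hmn ↦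
      Metric.closedBall_subset_closedBall (by exact_mod_cast hmn)
    have hU : ⋃ n, I n = Set.univ := Metric.iUnion_closedBall_nat 0
    have hρ := tendsto_measure_iUnion_atTop (μ := ρ) hImono
    have hσ := tendsto_measure_iUnion_atTop (μ := σ) hImono
    rw [hU] at hρ hσ
    exact (ENNReal.add_le_add_iff_right (measure_ne_top σ Set.univ)).1
      (le_of_tendsto' (hρ.add hσ) hn)
  have hγu : γ Set.univ = ρ Set.univ := le_antisymm (hfst _ MeasurableSet.univ) huniv
  have hγfin : IsFiniteMeasure γ := ⟨by rw [hγu]; exact measure_lt_top _ _⟩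
  refine ⟨f, ⟨hfm, hf0, hf1, ?_, ?_⟩, fun g ↦ ?_⟩
  · refine Measure.eq_of_le_of_measure_univ_eq (Measure.le_iff.2 fun E hE ↦ ?_) ?_
    · rw [Measure.map_apply measurable_fst hE]
      exact hfst E hE
    · rwa [Measure.map_apply measurable_fst MeasurableSet.univ]
  · refine Measure.eq_of_le_of_measure_univ_eq (Measure.le_iff.2 fun E hE ↦ ?_) ?_
    · rw [Measure.map_apply measurable_snd hE]
      exact hsnd E hE
    · rwa [Measure.map_apply measurable_snd MeasurableSet.univ, ← hm]
  · rw [hF, L2.inner_def]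
    refine integral_congr_ae ?_
    filter_upwards [hfF] with z hz
    simp [hz, mul_comm]

/-- The density of an extreme functional is an indicator function. -/
theorem ae_eq_zero_or_one_of_extreme {ρ σ : Measure ℝ} [IsFiniteMeasure ρ] {L : PlaneL2 → ℝ}
    (hL : L ∈ Set.extremePoints ℝ (subFunctionals ρ σ)) {f : ℝ × ℝ → ℝ}
    (hf : IsPlaneDensity ρ σ f) (hLf : ∀ g : PlaneL2, L g = ∫ z, f z * g z) :
    ∀ᵐ z, f z = 0 ∨ f z = 1 := by
  by_contra hcon
  have hfm := hf.measurable
  have hfi := hf.integrable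
  let T : ℕ → Set (ℝ × ℝ) := fun n ↦
    f ⁻¹' Set.Icc (1 / (n + 1 : ℝ)) (1 - 1 / (n + 1 : ℝ)) ∩ Metric.closedBall 0 n
  have hsub : {z | ¬(f z = 0 ∨ f z = 1)} ⊆ ⋃ n, T n := by
    intro z hz
    have hz' : ¬(f z = 0 ∨ f z = 1) := hz
    push Not at hz'
    have h0 : 0 < f z := (hf.nonneg z).lt_of_ne' hz'.1
    have h1 : f z < 1 := (hf.le_one z).lt_of_ne hz'.2
    obtain ⟨m, hm⟩ := exists_nat_one_div_lt (lt_min h0 (sub_pos.2 h1))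
    obtain ⟨k, hk⟩ := exists_nat_ge (dist z 0)
    have hmk : 1 / ((max m k : ℕ) + 1 : ℝ) ≤ 1 / (m + 1 : ℝ) := by
      apply one_div_le_one_div_of_le (by positivity)
      gcongr
      exact le_max_left m k
    refine Set.mem_iUnion.2 ⟨max m k, ⟨?_, ?_⟩, ?_⟩
    · exact hmk.trans (hm.le.trans (min_le_left _ _))
    · linarith [min_le_right (f z) (1 - f z)]
    · exact hk.trans (by exact_mod_cast le_max_right m k)
  obtain ⟨n, hn⟩ : ∃ n, volume (T n) ≠ 0 := by
    by_contra! h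
    exact hcon (measure_mono_null hsub (measure_iUnion_null h))
  set δ : ℝ := 1 / (n + 1 : ℝ)
  have hδ : 0 < δ := by positivity
  obtain ⟨S, h, hS, hSb, hS0, hh, hhT, hhS, hhi, hh1, hh2⟩ := exists_alternating
    (T := T n) ((hfm measurableSet_Icc).inter measurableSet_closedBall)
    (Metric.isBounded_closedBall.subset Set.inter_subset_right) hn
  have hmem : ∀ ε : ℝ, |ε| ≤ δ →
      (fun g : PlaneL2 ↦ ∫ z, (f z + ε * h z) * g z) ∈ subFunctionals ρ σ ∧
      ∀ g : PlaneL2, Integrable fun z ↦ (f z + ε * h z) * g z := by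
    intro ε hε
    have hfh : Measurable fun z ↦ f z + ε * h z := by fun_prop
    have hfhi : Integrable fun z ↦ f z + ε * h z := hfi.add (hhi.const_mul ε)
    have hbd : ∀ z, 0 ≤ f z + ε * h z ∧ f z + ε * h z ≤ 1 := by
      intro z
      have h3 : |ε * h z| ≤ δ * (T n).indicator 1 z := by
        rw [abs_mul]
        exact mul_le_mul hε (hhT z) (abs_nonneg _) hδ.le
      by_cases hz : z ∈ T n
      · rw [Set.indicator_of_mem hz, Pi.one_apply, mul_one, abs_le] at h3
        have h4 : δ ≤ f z ∧ f z ≤ 1 - δ := hz.1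
        constructor <;> linarith [h3.1, h3.2, h4.1, h4.2]
      · rw [Set.indicator_of_notMem hz, mul_zero] at h3
        rw [abs_eq_zero.1 (le_antisymm h3 (abs_nonneg _)), add_zero]
        exact ⟨hf.nonneg z, hf.le_one z⟩
    have hmarg : ∀ φ : ℝ × ℝ → ℝ, Measurable φ → (∃ C, ∀ z, |φ z| ≤ C) →
        ∫ z, h z * φ z = 0 → ∫ z, (f z + ε * h z) * φ z = ∫ z, f z * φ z := by
      rintro φ hφ ⟨C, hC⟩ h0
      have hi : ∀ {ψ : ℝ × ℝ → ℝ}, Integrable ψ → Integrable fun z ↦ ψ z * φ z := fun hψ ↦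
        hψ.mul_bdd (c := C) hφ.aestronglyMeasurable (Filter.Eventually.of_forall hC)
      simp only [add_mul, mul_assoc]
      rw [integral_add (hi hfi) ((hi hhi).const_mul ε), integral_const_mul, h0, mul_zero, add_zero]
    refine ⟨integral_mem_subFunctionals hfh (fun z ↦ (hbd z).1) (fun z ↦ (hbd z).2) hfhi ?_ ?_,
      integrable_mul_of_mem_Icc hfh (fun z ↦ (hbd z).1) (fun z ↦ (hbd z).2) hfhi⟩
    · rintro α hα ⟨C, hC⟩
      rw [hmarg (fun z ↦ α z.1) (by fun_prop) ⟨C, fun z ↦ hC _⟩ (hh1 α hα ⟨C, hC⟩),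
        hf.integral_fst hα]
    · rintro β hβ ⟨C, hC⟩
      rw [hmarg (fun z ↦ β z.2) (by fun_prop) ⟨C, fun z ↦ hC _⟩ (hh2 β hβ ⟨C, hC⟩),
        hf.integral_snd hβ]
  have hpos := hmem δ (abs_of_pos hδ).le
  have hneg := hmem (-δ) (by rw [abs_neg, abs_of_pos hδ])
  have heq := ((mem_extremePoints.1 hL).2 _ hpos.1 _ hneg.1
    ⟨1 / 2, 1 / 2, by norm_num, by norm_num, by norm_num, ?_⟩).1
  · have hS' : volume S ≠ ∞ := hSb.measure_lt_top.ne
    have h5 := congrFun heq (indicatorConstLp 2 hS hS' 1)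
    have h6 : ∀ φ : ℝ × ℝ → ℝ, ∫ z, φ z * (indicatorConstLp 2 hS hS' (1 : ℝ) : PlaneL2) z =
        ∫ z in S, φ z := by
      intro φ
      rw [← integral_indicator hS]
      refine integral_congr_ae ?_
      filter_upwards [indicatorConstLp_coeFn (p := 2) (hs := hS) (hμs := hS') (c := (1 : ℝ))]
        with z hz
      rw [hz]
      by_cases hzS : z ∈ S <;> simp [hzS]
    rw [hLf, h6] at h5
    simp only [h6] at h5
    rw [integral_add hfi.integrableOn (hhi.const_mul δ).integrableOn, integral_const_mul,
      setIntegral_congr_fun hS hhS] at h5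
    have h7 : 0 < volume.real S := ENNReal.toReal_pos hS0 hS'
    have h8 : 0 < δ * volume.real S := mul_pos hδ h7
    simp at h5
    rcases h5 with h5 | h5 <;> linarith
  · ext g
    simp only [Pi.add_apply, Pi.smul_apply, smul_eq_mul, hLf]
    rw [← integral_const_mul, ← integral_const_mul,
      ← integral_add ((hpos.2 g).const_mul _) ((hneg.2 g).const_mul _)]
    refine integral_congr_ae (Filter.Eventually.of_forall fun z ↦ ?_)
    simp only
    ring

/-- Under the cut condition, some plane set has marginals `ρ` and `σ`. -/
theorem exists_set_of_cut {ρ σ : Measure ℝ} [IsFiniteMeasure ρ] [IsFiniteMeasure σ]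
    (hcut : ∀ E G : Set ℝ, MeasurableSet E → MeasurableSet G →
      ρ E ≤ σ G + volume E * volume Gᶜ) (hm : ρ Set.univ = σ Set.univ) :
    ∃ A : Set (ℝ × ℝ), MeasurableSet A ∧
      (∀ E, MeasurableSet E → volume (Prod.fst ⁻¹' E ∩ A) = ρ E) ∧
      (∀ E, MeasurableSet E → volume (Prod.snd ⁻¹' E ∩ A) = σ E) := by
  obtain ⟨L, hL⟩ := isCompact_subFunctionals.extremePoints_nonempty (subFunctionals_nonempty hcut)
  obtain ⟨f, hf, hLf⟩ := exists_isPlaneDensity hm hL.1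
  have h01 := ae_eq_zero_or_one_of_extreme hL hf hLf
  have hA : MeasurableSet (f ⁻¹' {1}) := hf.measurable (measurableSet_singleton 1)
  have hvol : ∀ W, MeasurableSet W → volume (W ∩ f ⁻¹' {1}) =
      volume.withDensity (fun z ↦ ENNReal.ofReal (f z)) W := by
    intro W hW
    rw [withDensity_apply _ hW, Set.inter_comm, ← Measure.restrict_apply hA,
      ← lintegral_indicator_one hA]
    refine lintegral_congr_ae (ae_restrict_of_ae ?_)
    filter_upwards [h01] with z hz
    rcases hz with hz | hz <;> simp [hz]
  refine ⟨f ⁻¹' {1}, hA, fun E hE ↦ ?_, fun E hE ↦ ?_⟩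
  · rw [hvol _ (measurable_fst hE), ← Measure.map_apply measurable_fst hE, hf.map_fst]
  · rw [hvol _ (measurable_snd hE), ← Measure.map_apply measurable_snd hE, hf.map_snd]

theorem distFn_congr {f g : ℝ → ℝ} (h : f =ᵐ[volume] g) : distFn volume f = distFn volume g := by
  funext s
  refine measure_congr ?_
  filter_upwards [h] with x hx
  exact congrArg (fun t ↦ s < |t|) hx

theorem rearr_congr {f g : ℝ → ℝ} (h : f =ᵐ[volume] g) : rearr volume f = rearr volume g := by
  funext t
  simp only [rearr, distFn_congr h]

theorem lorentz_plane_set_of_measurable {P Q : ℝ → ℝ} (hP : Measurable P) (hQ : Measurable Q)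
    (hP0 : ∀ x, 0 ≤ P x) (hQ0 : ∀ y, 0 ≤ Q y) (hPi : Integrable P) (hQi : Integrable Q) :
    (∃ A : Set (ℝ × ℝ), MeasurableSet A ∧
        (∀ᵐ x : ℝ, volume {y : ℝ | (x, y) ∈ A} = ENNReal.ofReal (P x)) ∧
        (∀ᵐ y : ℝ, volume {x : ℝ | (x, y) ∈ A} = ENNReal.ofReal (Q y))) ↔
      ((∀ x : ℝ, 0 < x →
          ∫⁻ u in Set.Ioo 0 x, rearr volume P u ≤ ∫⁻ u in Set.Ioo 0 x, distFn volume Q u) ∧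
       (∀ x : ℝ, 0 < x →
          ∫⁻ u in Set.Ioo 0 x, rearr volume Q u ≤ ∫⁻ u in Set.Ioo 0 x, distFn volume P u)) := by
  constructor
  · rintro ⟨A, hA, hAP, hAQ⟩
    exact ⟨fun x hx ↦ rearr_le_of_set hP hQ hP0 hQ0 hPi.lintegral_lt_top.ne hA hAP hAQ hx,
      fun x hx ↦ rearr_le_of_set hQ hP hQ0 hP0 hQi.lintegral_lt_top.ne
        (hA.preimage measurable_swap) hAQ hAP hx⟩
  · rintro ⟨h1, h2⟩
    have := isFiniteMeasure_withDensity_ofReal hPi.2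
    have := isFiniteMeasure_withDensity_ofReal hQi.2
    obtain ⟨A, hA, hfst, hsnd⟩ := exists_set_of_cut (cut_of_rearr_le hP hQ hP0 hQ0 h1) (by
      simpa using le_antisymm (lintegral_le_of_rearr_le hP hQ hP0 hQ0 h1)
        (lintegral_le_of_rearr_le hQ hP hQ0 hP0 h2))
    refine ⟨A, hA, ?_, ?_⟩
    · refine ae_eq_of_forall_setLIntegral_eq_of_sigmaFinite (measurable_measure_prodMk_left hA)
        hP.ennreal_ofReal fun E hE _ ↦ ?_
      rw [← withDensity_apply (fun t ↦ ENNReal.ofReal (P t)) hE, ← hfst E hE,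
        Measure.volume_eq_prod, Measure.prod_apply ((measurable_fst hE).inter hA), ← lintegral_indicator hE]
      refine lintegral_congr fun x ↦ ?_
      by_cases hx : x ∈ E <;> simp [Set.preimage, hx]
    · refine ae_eq_of_forall_setLIntegral_eq_of_sigmaFinite (measurable_measure_prodMk_right hA)
        hQ.ennreal_ofReal fun E hE _ ↦ ?_
      rw [← withDensity_apply (fun t ↦ ENNReal.ofReal (Q t)) hE, ← hsnd E hE,
        Measure.volume_eq_prod, Measure.prod_apply_symm ((measurable_snd hE).inter hA), ← lintegral_indicator hE]
      refine lintegral_congr fun x ↦ ?_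
      by_cases hx : x ∈ E <;> simp [Set.preimage, hx]

/-- **Lorentz's theorem.** For non-negative integrable `P, Q` on `ℝ`, a measurable plane set
`A` with vertical cross sections `P` and horizontal cross sections `Q` exists iff
`∫₀ˣ P*(u) du ≤ ∫₀ˣ λ_Q(u) du` and `∫₀ˣ Q*(u) du ≤ ∫₀ˣ λ_P(u) du` for all `x > 0`. -/
theorem lorentz_plane_set (P Q : ℝ → ℝ) (hP0 : ∀ x, 0 ≤ P x) (hQ0 : ∀ y, 0 ≤ Q y)
    (hPi : Integrable P volume) (hQi : Integrable Q volume) :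
    (∃ A : Set (ℝ × ℝ), MeasurableSet A ∧
        (∀ᵐ x : ℝ, volume {y : ℝ | (x, y) ∈ A} = ENNReal.ofReal (P x)) ∧
        (∀ᵐ y : ℝ, volume {x : ℝ | (x, y) ∈ A} = ENNReal.ofReal (Q y))) ↔
      ((∀ x : ℝ, 0 < x →
          ∫⁻ u in Set.Ioo 0 x, rearr volume P u ≤ ∫⁻ u in Set.Ioo 0 x, distFn volume Q u) ∧
       (∀ x : ℝ, 0 < x →
          ∫⁻ u in Set.Ioo 0 x, rearr volume Q u ≤ ∫⁻ u in Set.Ioo 0 x, distFn volume P u)) := by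
  obtain ⟨P', hP', hPP'⟩ := hPi.1.aemeasurable
  obtain ⟨Q', hQ', hQQ'⟩ := hQi.1.aemeasurable
  have hP : P =ᵐ[volume] fun x ↦ |P' x| := by
    filter_upwards [hPP'] with x hx
    rw [← hx, abs_of_nonneg (hP0 x)]
  have hQ : Q =ᵐ[volume] fun y ↦ |Q' y| := by
    filter_upwards [hQQ'] with y hy
    rw [← hy, abs_of_nonneg (hQ0 y)]
  rw [distFn_congr hP, distFn_congr hQ, rearr_congr hP, rearr_congr hQ,
    ← lorentz_plane_set_of_measurable (by fun_prop) (by fun_prop) (fun x ↦ abs_nonneg _)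
      (fun y ↦ abs_nonneg _) (hPi.congr hP) (hQi.congr hQ)]
  refine exists_congr fun A ↦ and_congr_right fun _ ↦ and_congr ?_ ?_
  · refine Filter.eventually_congr (hP.mono fun x hx ↦ ?_)
    rw [hx]
  · refine Filter.eventually_congr (hQ.mono fun y hy ↦ ?_)
    rw [hy]
end

section
/- Let p = (p₁,…,p_j) and q = (q₁,…,q_k) be two nonincreasing partitions of the same positive integer (i.e., p₁ ≥ ⋯ ≥ p_j ≥ 1, q₁ ≥ ⋯ ≥ q_k ≥ 1 are integers and p₁ + ⋯ + p_j = q₁ + ⋯ + q_k). Then there exists a j × k matrix A with entries in {0,1} whose row sums are p₁,…,p_j and whose column sums are q₁,…,q_k, if and only if for every positive integer m one has Σ_{i=1}^m q_i ≤ Σ_{i=1}^m p̂_i, where p̂_i = card{1 ≤ l ≤ j : p_l ≥ i} for 1 ≤ i ≤ p₁, p̂_i = 0 for i > p₁, and q_i = 0 for i > k. -/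
open Finset in
/-- The sum of an antitone sequence over a finite set of indices is at most the sum over the
initial segment with the same number of elements. -/
theorem Antitone.sum_le_sum_range_card {f : ℕ → ℕ} (hf : Antitone f) (s : Finset ℕ) :
    ∑ i ∈ s, f i ≤ ∑ i ∈ range s.card, f i := by
  induction s using Finset.induction_on_max with
  | empty => simp
  | insert a s h ih =>
    have ha : a ∉ s := fun h' => (h a h').false
    have hsub : s ⊆ range a := fun x hx => mem_range.2 (h x hx)
    have hcard : s.card ≤ a := by simpa using card_le_card hsub
    rw [sum_insert ha, card_insert_of_notMem ha, sum_range_succ, add_comm]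
    exact add_le_add ih (hf hcard)

open Finset in
/-- Double counting: partial sums of the conjugate sequence. -/
theorem sum_range_card_filter_succ_le {α : Type*} [Fintype α] (p : α → ℕ) (m : ℕ) :
    ∑ i ∈ range m, (univ.filter fun l => i + 1 ≤ p l).card = ∑ l, min (p l) m := by
  simp only [card_filter]
  rw [sum_comm]
  refine sum_congr rfl fun l _ => ?_
  rw [← card_filter, show (range m).filter (fun i => i + 1 ≤ p l) = range (min (p l) m) by
    ext i; simp; omega, card_range]

open Finset in
/-- A cut condition sufficient for the existence of a `(0,1)`-matrix with prescribed row sums `p`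
and column sums `q`. The matrix is read off from a matching, given by Hall's theorem, that assigns
distinct cells to `card β - p r` tokens for each row `r` (the zeros of that row) and `q c` tokens
for each column `c` (the ones of that column). -/
theorem exists_zero_one_matrix_of_cut_le {α β : Type*} [Fintype α] [Fintype β]
    [DecidableEq α] [DecidableEq β] (p : α → ℕ) (q : β → ℕ)
    (hsum : ∑ i, p i = ∑ i, q i)
    (hcut : ∀ (R : Finset α) (C : Finset β), ∑ c ∈ C, q c ≤ ∑ r ∈ R, p r + Rᶜ.card * C.card) :
    ∃ A : Matrix α β ℕ, (∀ r c, A r c = 0 ∨ A r c = 1) ∧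
      (∀ r, ∑ c, A r c = p r) ∧ (∀ c, ∑ r, A r c = q c) := by
  classical
  have hp (r : α) : p r ≤ Fintype.card β := by
    have h := hcut (univ.erase r) univ
    have h' := add_sum_erase univ p (mem_univ r)
    have hc : ((univ.erase r)ᶜ : Finset α).card = 1 := by
      rw [card_eq_one]; exact ⟨r, by ext; simp⟩
    rw [hc, one_mul, card_univ] at h
    omega
  let t : ((Σ r : α, Fin (Fintype.card β - p r)) ⊕ (Σ c : β, Fin (q c))) → Finset (α × β) :=
    Sum.elim (fun x => {x.1} ×ˢ univ) (fun x => univ ×ˢ {x.1})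
  have hall : ∀ s : Finset _, s.card ≤ (s.biUnion t).card := by
    intro s
    let R : Finset α := s.toLeft.image Sigma.fst
    let C : Finset β := s.toRight.image Sigma.fst
    have hN : (Rᶜ ×ˢ Cᶜ)ᶜ ⊆ s.biUnion t := by
      rintro ⟨r, c⟩ h
      have h : r ∈ R ∨ c ∈ C := by
        simp only [mem_compl, mem_product] at h
        tauto
      rcases h with h | h
      · obtain ⟨x, hx, rfl⟩ := mem_image.1 h
        exact mem_biUnion.2 ⟨Sum.inl x, mem_toLeft.1 hx, by simp [t]⟩
      · obtain ⟨x, hx, rfl⟩ := mem_image.1 h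
        exact mem_biUnion.2 ⟨Sum.inr x, mem_toRight.1 hx, by simp [t]⟩
    have hL : s.toLeft.card ≤ ∑ r ∈ R, (Fintype.card β - p r) := by
      calc s.toLeft.card ≤ (R.sigma fun _ => univ).card :=
            card_le_card fun x hx => mem_sigma.2 ⟨mem_image_of_mem _ hx, mem_univ _⟩
        _ = _ := by simp [card_sigma]
    have hR : s.toRight.card ≤ ∑ c ∈ C, q c := by
      calc s.toRight.card ≤ (C.sigma fun _ => univ).card :=
            card_le_card fun x hx => mem_sigma.2 ⟨mem_image_of_mem _ hx, mem_univ _⟩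
        _ = _ := by simp [card_sigma]
    have hadd : ∑ r ∈ R, (Fintype.card β - p r) + ∑ r ∈ R, p r =
        R.card * (C.card + Cᶜ.card) := by
      rw [card_add_card_compl, ← sum_add_distrib, sum_congr rfl fun r _ => Nat.sub_add_cancel (hp r)]
      simp
    have hcells := card_add_card_compl (Rᶜ ×ˢ Cᶜ)
    rw [card_product, Fintype.card_prod, ← card_add_card_compl R,
      ← card_add_card_compl C] at hcells
    have := card_toLeft_add_card_toRight (u := s)
    have := hcut R C
    have := card_le_card hN
    nlinarith
  obtain ⟨f, hf, hft⟩ := (all_card_le_biUnion_card_iff_exists_injective t).1 hall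
  have hrow (x) : (f (Sum.inl x)).1 = x.1 :=
    mem_singleton.1 (mem_product.1 (hft (Sum.inl x))).1
  have hcol (x) : (f (Sum.inr x)).2 = x.1 :=
    mem_singleton.1 (mem_product.1 (hft (Sum.inr x))).2
  let A : Matrix α β ℕ := fun r c => if ∃ x, f (Sum.inr x) = (r, c) then 1 else 0
  have hAcol (c : β) : ∑ r, A r c = q c := by
    have himage : (univ.filter fun r => ∃ x, f (Sum.inr x) = (r, c)) =
        univ.image fun i : Fin (q c) => (f (Sum.inr ⟨c, i⟩)).1 := by
      ext r
      simp only [mem_filter, mem_univ, true_and, mem_image]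
      constructor
      · rintro ⟨⟨c', i⟩, h⟩
        obtain rfl : c' = c := (hcol ⟨c', i⟩).symm.trans (congrArg Prod.snd h)
        exact ⟨i, by rw [h]⟩
      · rintro ⟨i, rfl⟩
        exact ⟨⟨c, i⟩, Prod.ext rfl (hcol _)⟩
    simp only [A]
    rw [← card_filter, himage, card_image_of_injective, card_univ, Fintype.card_fin]
    intro i i' h
    have := hf (Prod.ext h ((hcol ⟨c, i⟩).trans (hcol ⟨c, i'⟩).symm))
    simpa using this
  have hArow (r : α) : ∑ c, A r c ≤ p r := by
    let Z : Finset β := univ.image fun i : Fin (Fintype.card β - p r) => (f (Sum.inl ⟨r, i⟩)).2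
    have hZ : Z.card = Fintype.card β - p r := by
      rw [card_image_of_injective, card_univ, Fintype.card_fin]
      intro i i' h
      have := hf (Prod.ext ((hrow ⟨r, i⟩).trans (hrow ⟨r, i'⟩).symm) h)
      simpa using this
    have hsub : (univ.filter fun c => ∃ x, f (Sum.inr x) = (r, c)) ⊆ Zᶜ := by
      intro c hc
      obtain ⟨x, hx⟩ := (mem_filter.1 hc).2
      rw [mem_compl, mem_image]
      rintro ⟨i, -, hi⟩
      have := hf (hx.trans (Prod.ext (hrow ⟨r, i⟩) hi).symm)
      simp at this
    simp only [A]
    rw [← card_filter]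
    have := card_le_card hsub
    have := card_add_card_compl Z
    have := hp r
    omega
  refine ⟨A, fun r c => ?_, fun r => ?_, hAcol⟩
  · simp only [A]
    split_ifs <;> simp
  · refine (sum_eq_sum_iff_of_le fun r _ => hArow r).1 ?_ r (mem_univ r)
    rw [hsum, sum_comm]
    exact sum_congr rfl fun c _ => hAcol c

/-- **Gale–Ryser theorem.** For two nonincreasing partitions `p`, `q` of the same positive
integer, a `(0,1)`-matrix with row sums `p` and column sums `q` exists iff for every positive
integer `m`, `∑_{i=1}^m q_i ≤ ∑_{i=1}^m p̂_i`, where `p̂_i = card{l : p_l ≥ i}` (so `p̂_i = 0`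
for `i > p₁`) and `q_i = 0` for `i > k`. -/
theorem gale_ryser (j k : ℕ) (p : Fin j → ℕ) (q : Fin k → ℕ)
    (hp1 : ∀ i, 1 ≤ p i) (hq1 : ∀ i, 1 ≤ q i)
    (hpa : Antitone p) (hqa : Antitone q)
    (hsum : ∑ i, p i = ∑ i, q i) (hpos : 0 < ∑ i, p i) :
    (∃ A : Matrix (Fin j) (Fin k) ℕ,
        (∀ r c, A r c = 0 ∨ A r c = 1) ∧
        (∀ r, ∑ c, A r c = p r) ∧
        (∀ c, ∑ r, A r c = q c)) ↔
      (∀ m : ℕ, 0 < m →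
        ∑ i ∈ Finset.range m, (if h : i < k then q ⟨i, h⟩ else 0) ≤
          ∑ i ∈ Finset.range m, (Finset.univ.filter fun l : Fin j => i + 1 ≤ p l).card) := by
  simp only [sum_range_card_filter_succ_le]
  set q' : ℕ → ℕ := fun i => if h : i < k then q ⟨i, h⟩ else 0 with hq'
  have hmap (C : Finset (Fin k)) : ∑ i ∈ C.map Fin.valEmbedding, q' i = ∑ c ∈ C, q c := by
    simp [hq']
  constructor
  · rintro ⟨A, hA, hrow, hcol⟩ m -
    have hfin : ∑ i ∈ Finset.range m, q' i = ∑ c : Fin k with c.1 < m, q c := by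
      rw [← hmap]
      symm
      refine Finset.sum_subset (fun i hi => ?_) fun i hi hi' => ?_
      · obtain ⟨c, hc, rfl⟩ := Finset.mem_map.1 hi
        simpa using hc
      · refine dif_neg fun h => hi' (Finset.mem_map.2 ⟨⟨i, h⟩, ?_, rfl⟩)
        simpa using hi
    rw [hfin, ← Finset.sum_congr rfl fun c _ => hcol c, Finset.sum_comm]
    refine Finset.sum_le_sum fun r _ => le_min ?_ ?_
    · rw [← hrow r]
      exact Finset.sum_le_sum_of_subset (Finset.filter_subset _ _)
    · calc ∑ c : Fin k with c.1 < m, A r c ≤ ∑ c : Fin k with c.1 < m, 1 :=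
            Finset.sum_le_sum fun c _ => by rcases hA r c with h | h <;> simp [h]
        _ = ((Finset.univ.filter fun c : Fin k => c.1 < m).map Fin.valEmbedding).card := by simp
        _ ≤ (Finset.range m).card := Finset.card_le_card fun i hi => by
            obtain ⟨c, hc, rfl⟩ := Finset.mem_map.1 hi
            simpa using hc
        _ = m := Finset.card_range m
  · intro h
    have hanti : Antitone q' := by
      intro a b hab
      simp only [hq']
      split_ifs with hb ha
      · exact hqa hab
      · omega
      · exact Nat.zero_le _
      · exact le_rfl
    refine exists_zero_one_matrix_of_cut_le p q hsum fun R C => ?_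
    have hC : ∑ c ∈ C, q c ≤ ∑ i ∈ Finset.range C.card, q' i := by
      rw [← hmap, ← Finset.card_map Fin.valEmbedding]
      exact hanti.sum_le_sum_range_card _
    rcases C.card.eq_zero_or_pos with h0 | h0
    · simp [Finset.card_eq_zero.1 h0]
    · refine hC.trans ((h _ h0).trans ?_)
      rw [← Finset.sum_add_sum_compl R]
      refine add_le_add (Finset.sum_le_sum fun r _ => min_le_left _ _) ?_
      exact Finset.sum_le_card_nsmul _ _ _ fun r _ => min_le_right _ _
end

section
/- Let {E_n}_{n∈ℕ} be a sequence of Lebesgue-measurable subsets of ℝ^d and let E = ⋃_{m∈ℕ} ⋂_{k=m}^∞ E_k be its lower limit. If |E| < ∞ and Σ_{n∈ℕ} |E_n ∖ E_{n+1}| < ∞, then E_n → E in measure, i.e., |E_n Δ E| → 0 as n → ∞. -/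
open MeasureTheory Filter

/-- A point of `E n` that leaves some later set of the sequence leaves at a consecutive step. -/
lemma diff_iInter_subset_iUnion_diff_succ {α : Type*} (E : ℕ → Set α) (n : ℕ) :
    E n \ ⋂ k, ⋂ (_ : n ≤ k), E k ⊆ ⋃ i, E (i + n) \ E (i + n + 1) := by
  rintro x ⟨hx, hx'⟩
  by_contra hstep
  simp only [Set.mem_iUnion, Set.mem_sdiff, not_exists, not_and, not_not] at hstep
  refine hx' (Set.mem_iInter₂.2 fun k hk => ?_)
  induction k, hk using Nat.le_induction with
  | base => exact hx
  | succ k hk ih =>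
    have h := hstep (k - n)
    rw [Nat.sub_add_cancel hk] at h
    exact h ih

/-- If the lower limit of a sequence of measurable sets has finite measure and the measures of
`E n \ E (n + 1)` are summable, then the sequence converges in measure to its lower limit. -/
lemma tendsto_measure_symmDiff_lowerLimit {α : Type*} [MeasurableSpace α] (μ : Measure α)
    (E : ℕ → Set α) (hE : ∀ n, MeasurableSet (E n))
    (hfin : μ (⋃ m, ⋂ k, ⋂ (_ : m ≤ k), E k) ≠ ⊤)
    (hsum : ∑' n, μ (E n \ E (n + 1)) ≠ ⊤) :
    Tendsto (fun n => μ (symmDiff (E n) (⋃ m, ⋂ k, ⋂ (_ : m ≤ k), E k))) atTop (nhds 0) := by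
  set F : ℕ → Set α := fun m => ⋂ k, ⋂ (_ : m ≤ k), E k
  have hFm : ∀ m, MeasurableSet (F m) := fun m =>
    MeasurableSet.iInter fun k => MeasurableSet.iInter fun _ => hE k
  have hmono : Monotone F := fun a b hab =>
    Set.subset_iInter₂ fun k hk => Set.iInter₂_subset k (hab.trans hk)
  have htail := ENNReal.tendsto_sum_nat_add (fun n => μ (E n \ E (n + 1))) hsum
  have hdiff : Tendsto (fun n => μ ((⋃ m, F m) \ F n)) atTop (nhds 0) := by
    have hanti : Antitone fun n => (⋃ m, F m) \ F n := fun a b hab =>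
      Set.sdiff_subset_sdiff_right (hmono hab)
    have h := tendsto_measure_iInter_atTop (μ := μ)
      (fun n => ((MeasurableSet.iUnion hFm).diff (hFm n)).nullMeasurableSet) hanti
      ⟨0, measure_ne_top_of_subset Set.sdiff_subset hfin⟩
    rwa [← Set.sdiff_iUnion, Set.sdiff_self, measure_empty] at h
  refine tendsto_of_tendsto_of_tendsto_of_le_of_le tendsto_const_nhds
    (by simpa using htail.add hdiff) (fun _ => zero_le) fun n => ?_
  refine (measure_union_le _ _).trans (add_le_add ?_ (measure_mono ?_))
  · refine (measure_mono ?_).trans (measure_iUnion_le _)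
    exact (Set.sdiff_subset_sdiff_right (Set.subset_iUnion F n)).trans
      (diff_iInter_subset_iUnion_diff_succ E n)
  · exact Set.sdiff_subset_sdiff_right (Set.iInter₂_subset n le_rfl)

/-- If the lower limit `E` of a sequence of measurable sets `Eₙ ⊆ ℝ^d` has finite measure and
`Σₙ |Eₙ ∖ Eₙ₊₁| < ∞`, then `Eₙ → E` in measure, i.e. `|Eₙ Δ E| → 0`. -/
theorem lower_limit_convergence {d : ℕ} (E : ℕ → Set (Fin d → ℝ))
    (hE : ∀ n, MeasurableSet (E n))
    (L : Set (Fin d → ℝ)) (hL : L = ⋃ m, ⋂ k, ⋂ (_ : m ≤ k), E k)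
    (hfin : volume L < ⊤)
    (hsum : ∑' n, volume (E n \ E (n + 1)) < ⊤) :
    Tendsto (fun n => volume (symmDiff (E n) L)) atTop (nhds 0) := by
  subst hL
  exact tendsto_measure_symmDiff_lowerLimit volume E hE hfin.ne hsum.ne
end
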